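/- arXiv:1101.2151 — 3 statements merged into one kernel-verified Lean document; each statement's English description precedes it below -/
import Mathlib

section
/- Let F₂ be the free group on generators t₁, t₂ and suppose w = t₁^{α₁} t₂^{β₁} t₁^{α₂} t₂^{β₂} ⋯ t₁^{α_m} t₂^{β_m} is a cyclically reduced word with all α_i ≠ 0 and all β_i ≠ 0. If w is a primitive element of F₂, then all the α_i have the same sign and all the β_i have the same sign. -/
/-- The free group on two generators. -/
abbrev F2 : Type := FreeGroup (Fin 2)

/-- The first generator `t₁`. -/
def t1 : F2 := FreeGroup.of 0

/-- The second generator `t₂`. -/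
def t2 : F2 := FreeGroup.of 1

/-- An element of `F₂` is primitive if it belongs to some generating pair of `F₂`
(by Nielsen's theorem, any generating pair is automatically a free basis). -/
def Primitive (w : F2) : Prop := ∃ z : F2, Subgroup.closure ({w, z} : Set F2) = ⊤

namespace FreeGroup.Nielsen

/-- length of the longest common prefix -/
def lcp {A : Type*} [DecidableEq A] : List A → List A → ℕ
  | a :: l, b :: m => if a = b then lcp l m + 1 else 0
  | _, _ => 0

theorem le_lcp {A : Type*} [DecidableEq A] (l m : List A) (n : ℕ) :
    n ≤ lcp l m ↔ n ≤ l.length ∧ n ≤ m.length ∧ l.take n = m.take n := by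
  induction l generalizing m n with
  | nil => cases n <;> simp [lcp]
  | cons a l ih =>
    cases m with
    | nil => cases n <;> simp [lcp]
    | cons b m =>
      cases n with
      | zero => simp
      | succ n =>
        by_cases h : a = b
        · simp [lcp, h, ih]
        · simp [lcp, h]

theorem norm_mk_of_reduced {l : List (Fin 2 × Bool)} (h : IsReduced l) :
    norm (mk l) = l.length := by
  simp [norm, h.reduce_eq]

theorem isReduced_invRev {l : List (Fin 2 × Bool)} (h : IsReduced l) :
    IsReduced (invRev l) := by
  rw [isReduced_iff_reduce_eq, reduce_invRev, h.reduce_eq]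

theorem norm_lcp (l m : List (Fin 2 × Bool)) (hl : IsReduced l) (hm : IsReduced m) :
    norm ((mk l)⁻¹ * mk m) + 2 * lcp l m = l.length + m.length := by
  induction l generalizing m with
  | nil =>
    have : (mk ([] : List (Fin 2 × Bool))) = 1 := rfl
    simp [lcp, this, norm_mk_of_reduced hm]
  | cons a l ih =>
    cases m with
    | nil =>
      have : (mk ([] : List (Fin 2 × Bool))) = 1 := rfl
      simp only [lcp, this, mul_one, norm_inv_eq, norm_mk_of_reduced hl]
      simp
    | cons b m =>
      by_cases h : a = b
      · subst h
        have e : ∀ k, mk (a :: k) = mk [a] * mk k := fun k => by simp [mul_mk]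
        have := ih m (hl.infix (List.suffix_cons a l).isInfix)
          (hm.infix (List.suffix_cons a m).isInfix)
        have e2 : (mk (a :: l))⁻¹ * mk (a :: m) = (mk l)⁻¹ * mk m := by
          rw [e l, e m]; group
        rw [e2]
        simp only [lcp, if_true, List.length_cons]
        omega
      · have : IsReduced (invRev (a :: l) ++ (b :: m)) := by
          have h1 := isReduced_invRev hl
          rw [IsReduced, List.isChain_append]
          refine ⟨h1, hm, ?_⟩
          intro x hx y hy
          simp [invRev] at hx hy
          subst hx hy
          obtain ⟨a1, a2⟩ := a
          obtain ⟨b1, b2⟩ := b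
          simp at h ⊢
          intro hh
          have := h hh
          revert this
          cases a2 <;> cases b2 <;> simp
        rw [inv_mk, mul_mk, norm_mk_of_reduced this]
        simp [lcp, h]

/-- common prefix length of elements of the free group -/
def d (x y : F2) : ℕ := lcp x.toWord y.toWord

theorem hd (x y : F2) : norm (x⁻¹ * y) + 2 * d x y = norm x + norm y := by
  have := norm_lcp x.toWord y.toWord isReduced_toWord isReduced_toWord
  rwa [mk_toWord, mk_toWord] at this

theorem d_comm (x y : F2) : d x y = d y x := by
  have h1 := hd x y
  have h2 := hd y x
  have : norm (x⁻¹ * y) = norm (y⁻¹ * x) := by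
    rw [← norm_inv_eq]; simp
  omega

theorem d_ultra (x y z : F2) (n : ℕ) (h1 : n ≤ d x z) (h2 : n ≤ d z y) : n ≤ d x y := by
  unfold d at *
  rw [le_lcp] at *
  exact ⟨h1.1, h2.2.1, h1.2.2.trans h2.2.2⟩

theorem d_le_left (x y : F2) : d x y ≤ norm x := ((le_lcp _ _ _).1 le_rfl).1

theorem d_le_right (x y : F2) : d x y ≤ norm y := ((le_lcp _ _ _).1 le_rfl).2.1

theorem exists_split (y : F2) (j : ℕ) (h : j ≤ norm y) :
    ∃ p q : F2, y = p * q ∧ norm p = j ∧ norm q = norm y - j := by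
  refine ⟨mk (y.toWord.take j), mk (y.toWord.drop j), ?_, ?_, ?_⟩
  · rw [mul_mk, List.take_append_drop, mk_toWord]
  · rw [norm_mk_of_reduced (isReduced_toWord.infix (List.take_prefix _ _).isInfix)]
    simpa [norm] using h
  · rw [norm_mk_of_reduced (isReduced_toWord.infix (List.drop_suffix _ _).isInfix)]
    simp [norm]

theorem sq (x : F2) (hx : x ≠ 1) : 2 * d x⁻¹ x < norm x := by
  by_contra hcon
  push Not at hcon
  have hk := (le_lcp x⁻¹.toWord x.toWord (d x⁻¹ x)).1 le_rfl
  set k := d x⁻¹ x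
  obtain ⟨-, hk2, hk3⟩ := hk
  have hred : IsReduced x.toWord := isReduced_toWord
  have hpos : norm x ≠ 0 := by simpa using hx
  rw [toWord_inv] at hk3
  unfold norm at hpos hcon
  generalize x.toWord = L at *
  have key : ∀ i (hi : i < k), L[L.length - 1 - i]?.map (fun g => (g.1, !g.2)) = L[i]? := by
    intro i hi
    have := congrArg (fun l => l[i]?) hk3
    simp only [List.getElem?_take, hi, if_true] at this
    rw [← this, invRev, List.getElem?_reverse (by simp; omega)]
    simp
  obtain ⟨r, hr | hr⟩ : ∃ r, L.length = 2 * r + 1 ∨ L.length = 2 * r + 2 :=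
    ⟨(L.length - 1) / 2, by omega⟩
  · have := key r (by omega)
    rw [show L.length - 1 - r = r by omega, List.getElem?_eq_getElem (by omega)] at this
    simp at this
    have := congrArg Prod.snd this
    simp at this
  · have := key r (by omega)
    rw [show L.length - 1 - r = r + 1 by omega, List.getElem?_eq_getElem (by omega),
      List.getElem?_eq_getElem (by omega)] at this
    have h2 := List.isChain_iff_getElem.1 hred r (by omega)
    simp at this
    rw [← this] at h2
    simp at h2

/-- reduced products of letters from `X` -/
inductive R (X : Set F2) : F2 → F2 → Prop
  | base (x) : x ∈ X → R X x x
  | step (w x y) : R X w x → y ∈ X → y ≠ x⁻¹ → R X (w * y) y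

structure NRed (X : Set F2) : Prop where
  inv : ∀ x ∈ X, x⁻¹ ∈ X
  h1 : ∀ x ∈ X, ∀ y ∈ X, y ≠ x⁻¹ → 2 * d x⁻¹ y ≤ norm x ∧ 2 * d x⁻¹ y ≤ norm y
  h2 : ∀ x ∈ X, ∀ y ∈ X, ∀ z ∈ X, y ≠ x⁻¹ → z ≠ y⁻¹ → d x⁻¹ y + d y⁻¹ z < norm y

theorem R.mem {X : Set F2} {w x : F2} (h : R X w x) : x ∈ X := by
  cases h <;> assumption

theorem hm (x y : F2) : norm (x * y) + 2 * d x⁻¹ y = norm x + norm y := by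
  have := hd x⁻¹ y
  simpa using this

theorem R.key {X : Set F2} (hX : NRed X) {w x : F2} (h : R X w x) :
    (∀ y ∈ X, y ≠ x⁻¹ → d w⁻¹ y = d x⁻¹ y) ∧ norm x ≤ norm w ∧
      w ∈ Subgroup.closure {x ∈ X | norm x ≤ norm w} := by
  induction h with
  | base x hx =>
    exact ⟨fun _ _ _ => rfl, le_rfl, Subgroup.subset_closure ⟨hx, le_rfl⟩⟩
  | step w x y hw hy hyx ih =>
    obtain ⟨i1, i2, i3⟩ := ih
    have hx := hw.mem
    have e1 := i1 y hy hyx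
    have e2 := hm w y
    obtain ⟨a1, a2⟩ := hX.h1 x hx y hy hyx
    have c1 : norm w ≤ norm (w * y) := by omega
    have c2 : norm y ≤ norm (w * y) := by omega
    refine ⟨?_, c2, ?_⟩
    · intro z hz hzy
      have b := hX.h2 x hx y hy z hz hyx hzy
      have e3 := hd (w * y)⁻¹ y⁻¹
      have e4 : ((w * y)⁻¹)⁻¹ * y⁻¹ = w := by group
      rw [e4] at e3
      simp only [norm_inv_eq] at e3
      apply le_antisymm
      · by_contra hlt
        push Not at hlt
        have e5 := d_comm y⁻¹ (w * y)⁻¹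
        have := d_ultra y⁻¹ z (w * y)⁻¹ (d y⁻¹ z + 1) (by omega) (by omega)
        omega
      · exact d_ultra _ _ y⁻¹ _ (by omega) le_rfl
    · refine Subgroup.mul_mem _ ?_ (Subgroup.subset_closure ⟨hy, c2⟩)
      refine Subgroup.closure_mono ?_ i3
      intro g hg
      exact ⟨hg.1, hg.2.trans c1⟩

theorem R.mul {X : Set F2} {w : F2} (h : w = 1 ∨ ∃ x, R X w x) (y : F2) (hy : y ∈ X) :
    w * y = 1 ∨ ∃ x, R X (w * y) x := by
  rcases h with rfl | ⟨x, h⟩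
  · right; exact ⟨y, by simpa using R.base y hy⟩
  · by_cases hyx : y = x⁻¹
    · subst hyx
      cases h with
      | base _ h => left; simp
      | step w x' _ h1 h2 h3 => right; exact ⟨x', by simpa using h1⟩
    · right; exact ⟨y, R.step _ _ _ h hy hyx⟩

theorem NRed.key {X : Set F2} (hX : NRed X) {w : F2} (h : w ∈ Subgroup.closure X) :
    w ∈ Subgroup.closure {x ∈ X | norm x ≤ norm w} := by
  have : w = 1 ∨ ∃ x, R X w x := by
    induction h using Subgroup.closure_induction_right with
    | one => left; rfl
    | mul_right x hx y hy ih => exact R.mul ih y hy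
    | mul_inv_cancel x hx y hy ih => exact R.mul ih _ (hX.inv y hy)
  rcases this with rfl | ⟨x, h⟩
  · exact Subgroup.one_mem _
  · exact (h.key hX).2.2

/-- standard positive pairs -/
inductive T : F2 → F2 → Prop
  | base (e f : ℤ) (he : e = 1 ∨ e = -1) (hf : f = 1 ∨ f = -1) : T (t1 ^ e) (t2 ^ f)
  | base' (e f : ℤ) (he : e = 1 ∨ e = -1) (hf : f = 1 ∨ f = -1) : T (t2 ^ f) (t1 ^ e)
  | left (u v) : T u v → T u (u * v)
  | right (u v) : T u v → T (u * v) v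

/-- exponent sum homomorphism -/
def ab (i : Fin 2) : F2 →* Multiplicative ℤ :=
  FreeGroup.lift (fun j => Multiplicative.ofAdd (if j = i then 1 else 0))

def es (i : Fin 2) (x : F2) : ℤ := (ab i x).toAdd

theorem es_mul (i x y) : es i (x * y) = es i x + es i y := by simp [es]
theorem es_inv (i x) : es i x⁻¹ = - es i x := by simp [es]
theorem es_zpow (i x) (n : ℤ) : es i (x ^ n) = n * es i x := by simp [es]
theorem es_pow (i x) (n : ℕ) : es i (x ^ n) = n * es i x := by simp [es]
theorem es_conj (i g x) : es i (g * x * g⁻¹) = es i x := by simp [es_mul, es_inv]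
theorem es_one (i) : es i 1 = 0 := by simp [es]
theorem es00 : es 0 t1 = 1 := by simp [es, ab, t1]
theorem es01 : es 0 t2 = 0 := by simp [es, ab, t2]
theorem es10 : es 1 t1 = 0 := by simp [es, ab, t1]
theorem es11 : es 1 t2 = 1 := by simp [es, ab, t2]

def Pos (e f : ℤ) (x : F2) : Prop := (norm x : ℤ) ≤ e * es 0 x + f * es 1 x

theorem Pos.mul {e f : ℤ} {x y : F2} (hx : Pos e f x) (hy : Pos e f y) : Pos e f (x * y) := by
  unfold Pos at *
  have := norm_mul_le x y
  rw [es_mul, es_mul]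
  have : (norm (x * y) : ℤ) ≤ norm x + norm y := by exact_mod_cast this
  linarith

theorem norm_t1 (e : ℤ) (he : e = 1 ∨ e = -1) : norm (t1 ^ e) = 1 := by
  rcases he with rfl | rfl <;> simp [t1]
theorem norm_t2 (e : ℤ) (he : e = 1 ∨ e = -1) : norm (t2 ^ e) = 1 := by
  rcases he with rfl | rfl <;> simp [t2]

theorem T.pos {u v : F2} (h : T u v) : ∃ e f : ℤ, (e = 1 ∨ e = -1) ∧ (f = 1 ∨ f = -1) ∧
    Pos e f u ∧ Pos e f v := by
  induction h with
  | base e f he hf =>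
    refine ⟨e, f, he, hf, ?_, ?_⟩
    · simp only [Pos, norm_t1 e he, es_zpow, es00, es10]
      rcases he with rfl | rfl <;> simp
    · simp only [Pos, norm_t2 f hf, es_zpow, es01, es11]
      rcases hf with rfl | rfl <;> simp
  | base' e f he hf =>
    refine ⟨e, f, he, hf, ?_, ?_⟩
    · simp only [Pos, norm_t2 f hf, es_zpow, es01, es11]
      rcases hf with rfl | rfl <;> simp
    · simp only [Pos, norm_t1 e he, es_zpow, es00, es10]
      rcases he with rfl | rfl <;> simp
  | left u v _ ih =>
    obtain ⟨e, f, he, hf, h1, h2⟩ := ih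
    exact ⟨e, f, he, hf, h1, h1.mul h2⟩
  | right u v _ ih =>
    obtain ⟨e, f, he, hf, h1, h2⟩ := ih
    exact ⟨e, f, he, hf, h1.mul h2, h2⟩

theorem T.swap {u v : F2} (h : T u v) : ∃ g, T (g * v * g⁻¹) (g * u * g⁻¹) := by
  induction h with
  | base e f he hf => exact ⟨1, by simpa using T.base' e f he hf⟩
  | base' e f he hf => exact ⟨1, by simpa using T.base e f he hf⟩
  | left u v _ ih =>
    obtain ⟨g, hg⟩ := ih
    refine ⟨g * u⁻¹, ?_⟩
    convert T.right _ _ hg using 1 <;> group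
  | right u v _ ih =>
    obtain ⟨g, hg⟩ := ih
    refine ⟨g * v, ?_⟩
    convert T.left _ _ hg using 1 <;> group

def Good (u v : F2) : Prop := ∃ g u' v', T u' v' ∧
  (u = g * u' * g⁻¹ ∨ u = g * u'⁻¹ * g⁻¹) ∧ (v = g * v' * g⁻¹ ∨ v = g * v'⁻¹ * g⁻¹)

theorem T.good {u v : F2} (h : T u v) : Good u v :=
  ⟨1, u, v, h, by simp, by simp⟩

theorem Good.conj {u v : F2} (h : Good u v) (k : F2) : Good (k * u * k⁻¹) (k * v * k⁻¹) := by
  obtain ⟨g, u', v', hT, h1, h2⟩ := h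
  refine ⟨k * g, u', v', hT, ?_, ?_⟩
  · rcases h1 with rfl | rfl
    · left; group
    · right; group
  · rcases h2 with rfl | rfl
    · left; group
    · right; group

theorem Good.of_conj {u v : F2} (k : F2) (h : Good (k * u * k⁻¹) (k * v * k⁻¹)) : Good u v := by
  have := h.conj k⁻¹
  convert this using 1 <;> group

theorem Good.inv_left {u v : F2} (h : Good u v) : Good u⁻¹ v := by
  obtain ⟨g, u', v', hT, h1, h2⟩ := h
  refine ⟨g, u', v', hT, ?_, h2⟩
  rcases h1 with rfl | rfl
  · right; group
  · left; group

theorem Good.swap {u v : F2} (h : Good u v) : Good v u := by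
  obtain ⟨g, u', v', hT, h1, h2⟩ := h
  obtain ⟨k, hk⟩ := hT.swap
  refine ⟨g * k⁻¹, _, _, hk, ?_, ?_⟩
  · rcases h2 with rfl | rfl
    · left; group
    · right; group
  · rcases h1 with rfl | rfl
    · left; group
    · right; group

theorem Good.inv_right {u v : F2} (h : Good u v) : Good u v⁻¹ := h.swap.inv_left.swap

theorem T.right' {u v : F2} (h : T u v) : Good (u * v⁻¹) v := by
  cases h with
  | base e f he hf =>
    have : T (t1 ^ e) (t2 ^ (-f)) := T.base e (-f) he (by omega)
    have := (T.right _ _ this).good.inv_right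
    simpa using this
  | base' e f he hf =>
    have : T (t2 ^ f) (t1 ^ (-e)) := T.base' (-e) f (by omega) hf
    have := (T.right _ _ this).good.inv_right
    simpa using this
  | left _ v h =>
    obtain ⟨g, hg⟩ := h.swap
    have := (T.left _ _ hg).good.inv_left
    apply Good.of_conj (g * u⁻¹)
    convert this using 1 <;> group
  | right u _ h =>
    have := h.good
    convert this using 1; group

theorem Good.mul {u v : F2} (h : Good u v) : Good (u * v) v := by
  obtain ⟨g, u', v', hT, h1, h2⟩ := h
  apply Good.of_conj g⁻¹
  rcases h1 with rfl | rfl <;> rcases h2 with rfl | rfl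
  · convert (T.right _ _ hT).good using 1 <;> group
  · convert hT.right'.inv_right using 1 <;> group
  · have := (hT.right'.inv_left.conj v'⁻¹)
    convert this using 1 <;> group
  · have := (T.right _ _ hT).good.inv_left.inv_right.conj v'
    convert this using 1 <;> group

def Gen (u v : F2) : Prop := ∀ H : Subgroup F2, u ∈ H → v ∈ H → H = ⊤

theorem not_zpowers (v : F2) : Subgroup.zpowers v ≠ ⊤ := by
  intro h
  have h1 : t1 ∈ Subgroup.zpowers v := h ▸ Subgroup.mem_top _
  have h2 : t2 ∈ Subgroup.zpowers v := h ▸ Subgroup.mem_top _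
  obtain ⟨a, ha⟩ := Subgroup.mem_zpowers_iff.1 h1
  obtain ⟨b, hb⟩ := Subgroup.mem_zpowers_iff.1 h2
  have : t1 * t2 = t2 * t1 := by
    rw [← ha, ← hb, ← zpow_add, ← zpow_add, add_comm]
  revert this
  unfold t1 t2
  decide

theorem Gen.not_mem {u v : F2} (h : Gen u v) : u ∉ Subgroup.zpowers v := fun hu =>
  not_zpowers v (h _ hu (Subgroup.mem_zpowers v))

def P (u v : F2) : Prop := Gen u v ∧ ¬ Good u v

theorem P.swap {u v : F2} (h : P u v) : P v u :=
  ⟨fun H a b => h.1 H b a, fun hg => h.2 hg.swap⟩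

theorem P.inv_left {u v : F2} (h : P u v) : P u⁻¹ v :=
  ⟨fun H a b => h.1 H (by simpa using a) b, fun hg => h.2 (by simpa using hg.inv_left)⟩

theorem P.mul {u v : F2} (h : P u v) : P (u * v) v :=
  ⟨fun H a b => h.1 H (by simpa using H.mul_mem a (H.inv_mem b)) b,
   fun hg => h.2 (by simpa using hg.inv_right.mul.inv_right)⟩

theorem P.mul_right {u v : F2} (h : P u v) : P u (u * v) := by
  have := h.swap.inv_left.swap.inv_left.swap.mul.inv_left.swap.inv_left
  simpa using this

theorem P.conj {u v : F2} (h : P u v) (k : F2) : P (k * u * k⁻¹) (k * v * k⁻¹) := by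
  refine ⟨fun H a b => ?_, fun hg => h.2 (hg.of_conj k)⟩
  have := h.1 (H.comap (MulAut.conj k).toMonoidHom) (by simpa using a) (by simpa using b)
  rw [eq_top_iff]
  intro x _
  have hx : k⁻¹ * x * k ∈ H.comap (MulAut.conj k).toMonoidHom := this ▸ Subgroup.mem_top _
  simp [mul_assoc] at hx
  exact hx

def Min (u v : F2) : Prop := P u v ∧ ∀ u' v', P u' v' → norm u + norm v ≤ norm u' + norm v'

theorem Min.swap {u v : F2} (h : Min u v) : Min v u :=
  ⟨h.1.swap, fun u' v' hp => by have := h.2 u' v' hp; omega⟩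

theorem Min.inv_left {u v : F2} (h : Min u v) : Min u⁻¹ v :=
  ⟨h.1.inv_left, fun u' v' hp => by have := h.2 u' v' hp; rw [norm_inv_eq]; omega⟩

theorem Min.inv_right {u v : F2} (h : Min u v) : Min u v⁻¹ := h.swap.inv_left.swap

theorem Min.ne_one {u v : F2} (h : Min u v) : u ≠ 1 := by
  rintro rfl
  exact h.1.1.not_mem (Subgroup.one_mem _)

theorem Min.h1 {x y : F2} (h : Min x y) : 2 * d x⁻¹ y ≤ norm x ∧ 2 * d x⁻¹ y ≤ norm y := by
  have e1 := h.2 _ _ h.1.mul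
  have e2 := h.2 _ _ h.1.mul_right
  have := hm x y
  omega

theorem Min.h2 {x y : F2} (h : Min x y) (a : 2 * d x⁻¹ y = norm y) (b : 2 * d y⁻¹ x = norm y) :
    False := by
  have hy := h.swap.ne_one
  have hy0 : norm y ≠ 0 := by simpa using hy
  obtain ⟨p, q, rfl, hp, hq⟩ := exists_split y (d x⁻¹ y) (d_le_right _ _)
  have hxy := h.h1.1
  generalize hk : d x⁻¹ (p * q) = k at *
  have e1 := hd p (p * q)
  rw [inv_mul_cancel_left] at e1
  have d1 : k ≤ d x⁻¹ p := d_ultra _ _ (p * q) _ hk.ge (by rw [d_comm]; omega)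
  have e2 := hd q⁻¹ (p * q)⁻¹
  have e3 : (q⁻¹)⁻¹ * (p * q)⁻¹ = p⁻¹ := by group
  rw [e3] at e2
  simp only [norm_inv_eq] at e2
  have d2 : k ≤ d q⁻¹ x := d_ultra _ _ (p * q)⁻¹ _ (by omega) (by omega)
  have e4 := hm q x
  have e5 := hd (q * x)⁻¹ x⁻¹
  have e6 : ((q * x)⁻¹)⁻¹ * x⁻¹ = q := by group
  rw [e6] at e5
  simp only [norm_inv_eq] at e5
  have l1 := d_le_left q⁻¹ x
  rw [norm_inv_eq] at l1
  have d3 : k ≤ d (q * x)⁻¹ p := d_ultra _ _ x⁻¹ _ (by omega) d1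
  have e7 := hm (q * x) p
  have hP := (h.1.swap.mul_right.swap).conj p⁻¹
  have f1 : p⁻¹ * (p * q * x) * p⁻¹⁻¹ = q * x * p := by group
  have f2 : p⁻¹ * (p * q) * p⁻¹⁻¹ = q * p := by group
  rw [f1, f2] at hP
  have e8 := h.2 _ _ hP
  have e9 := norm_mul_le q p
  omega

/-- the four letters -/
def X (u v : F2) : Set F2 := {x | x = u ∨ x = u⁻¹ ∨ x = v ∨ x = v⁻¹}

theorem Min.trip {u v : F2} (h : Min u v) (x y z : F2) (hx : x ∈ X u v) (hy : y ∈ X u v)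
    (hz : z ∈ X u v) :
    y = x ∨ y = x⁻¹ ∨ (Min x y ∧ (z = x ∨ z = x⁻¹ ∨ z = y ∨ z = y⁻¹)) := by
  have m1 := h
  have m2 := h.inv_left
  have m3 := h.inv_right
  have m4 := h.inv_left.inv_right
  have s1 := m1.swap
  have s2 := m2.swap
  have s3 := m3.swap
  have s4 := m4.swap
  rcases hx with rfl | rfl | rfl | rfl <;> rcases hy with rfl | rfl | rfl | rfl <;>
    first
    | (left; rfl)
    | (right; left; first | rfl | exact (inv_inv _).symm)
    | (right; right
       refine ⟨by assumption, ?_⟩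
       rcases hz with rfl | rfl | rfl | rfl <;> simp)

theorem Min.nred {u v : F2} (h : Min u v) : NRed (X u v) := by
  have n1 : ∀ x ∈ X u v, x ≠ 1 := by
    rintro x (rfl | rfl | rfl | rfl)
    · exact h.ne_one
    · exact h.inv_left.ne_one
    · exact h.swap.ne_one
    · exact h.inv_right.swap.ne_one
  have k1 : ∀ x ∈ X u v, ∀ y ∈ X u v, y ≠ x⁻¹ →
      2 * d x⁻¹ y ≤ norm x ∧ 2 * d x⁻¹ y ≤ norm y := by
    intro x hx y hy hne
    rcases h.trip x y y hx hy hy with rfl | h1 | h1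
    · have := sq y (n1 y hy); omega
    · exact absurd h1 hne
    · exact h1.1.h1
  refine ⟨?_, k1, ?_⟩
  · rintro x (rfl | rfl | rfl | rfl) <;> simp [X]
  · intro x hx y hy z hz hyx hzy
    have a1 := k1 x hx y hy hyx
    have a2 := k1 y hy z hz hzy
    have a3 := sq y (n1 y hy)
    rcases h.trip x y z hx hy hz with rfl | h1 | ⟨hM, h1⟩
    · omega
    · exact absurd h1 hyx
    · rcases h1 with rfl | rfl | rfl | rfl
      · by_contra hcon
        exact hM.h2 (by omega) (by omega)
      · by_contra hcon
        have c1 := d_comm y⁻¹ x⁻¹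
        have := d_ultra y⁻¹ y x⁻¹ (d x⁻¹ y) (by omega) le_rfl
        omega
      · omega
      · exact absurd rfl hzy

theorem norm_one_cases (x : F2) (h : norm x = 1) : ∃ e : ℤ, (e = 1 ∨ e = -1) ∧
    (x = t1 ^ e ∨ x = t2 ^ e) := by
  obtain ⟨⟨i, b⟩, hi⟩ := List.length_eq_one_iff.1 h
  have hx : x = mk [(i, b)] := by rw [← hi, mk_toWord]
  have hinv : mk [(i, false)] = (FreeGroup.of i)⁻¹ := by simp [FreeGroup.of, inv_mk, invRev]
  have hi2 : i = 0 ∨ i = 1 := by omega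
  cases b
  · refine ⟨-1, by simp, ?_⟩
    rcases hi2 with rfl | rfl
    · left; rw [hx, hinv]; simp [t1]
    · right; rw [hx, hinv]; simp [t2]
  · refine ⟨1, by simp, ?_⟩
    rcases hi2 with rfl | rfl
    · left; rw [hx]; simp [t1, FreeGroup.of]
    · right; rw [hx]; simp [t2, FreeGroup.of]

theorem Min.norm_le {u v : F2} (h : Min u v) : norm u ≤ 1 := by
  by_contra hcon
  have htop : Subgroup.closure (X u v) = ⊤ :=
    h.1.1 _ (Subgroup.subset_closure (by simp [X])) (Subgroup.subset_closure (by simp [X]))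
  have key : ∀ t : F2, norm t = 1 → t ∈ Subgroup.zpowers v := by
    intro t ht
    have := h.nred.key (w := t) (htop ▸ Subgroup.mem_top _)
    rw [ht] at this
    refine (Subgroup.closure_le _).2 ?_ this
    rintro x ⟨rfl | rfl | rfl | rfl, hx⟩
    · exact absurd hx hcon
    · rw [norm_inv_eq] at hx; exact absurd hx hcon
    · exact Subgroup.mem_zpowers _
    · exact Subgroup.inv_mem _ (Subgroup.mem_zpowers _)
  apply not_zpowers v
  rw [eq_top_iff, ← FreeGroup.closure_range_of, Subgroup.closure_le]
  rintro _ ⟨i, rfl⟩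
  exact key _ (norm_of i)

theorem not_min (u v : F2) (h : Min u v) : False := by
  have h1 : norm u = 1 := by
    have := h.norm_le
    have := h.ne_one
    have : norm u ≠ 0 := by simpa using this
    omega
  have h2 : norm v = 1 := by
    have := h.swap.norm_le
    have := h.swap.ne_one
    have : norm v ≠ 0 := by simpa using this
    omega
  obtain ⟨e, he, hu⟩ := norm_one_cases u h1
  obtain ⟨f, hf, hv⟩ := norm_one_cases v h2
  have aux : ∀ t : F2, t ^ e ∈ Subgroup.zpowers (t ^ f) := by
    intro t
    rw [Subgroup.mem_zpowers_iff]
    refine ⟨e * f, ?_⟩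
    rw [← zpow_mul]
    rcases he with rfl | rfl <;> rcases hf with rfl | rfl <;> simp
  rcases hu with rfl | rfl <;> rcases hv with rfl | rfl
  · exact h.1.1.not_mem (aux _)
  · exact h.1.2 (T.base e f he hf).good
  · exact h.1.2 (T.base' f e hf he).good
  · exact h.1.1.not_mem (aux _)

theorem Gen.good {u v : F2} (h : Gen u v) : Good u v := by
  by_contra hcon
  have hP : ∃ n u v, P u v ∧ norm u + norm v = n := ⟨_, u, v, ⟨h, hcon⟩, rfl⟩
  classical
  obtain ⟨a, b, hab, hn⟩ := Nat.find_spec hP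
  refine not_min a b ⟨hab, fun u' v' hp => ?_⟩
  rw [hn]
  exact Nat.find_min' hP ⟨u', v', hp, rfl⟩

/-- Positivity of primitive elements up to conjugation. -/
theorem primitive_pos {w : F2} (h : Primitive w) : ∃ (g : F2) (e f : ℤ),
    (e = 1 ∨ e = -1) ∧ (f = 1 ∨ f = -1) ∧ Pos e f (g⁻¹ * w * g) := by
  obtain ⟨z, hz⟩ := h
  have hG : Gen w z := by
    intro H h1 h2
    rw [eq_top_iff, ← hz, Subgroup.closure_le]
    rintro x (rfl | rfl) <;> assumption
  obtain ⟨g, u', v', hT, h1, -⟩ := hG.good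
  obtain ⟨e, f, he, hf, hp, -⟩ := hT.pos
  rcases h1 with rfl | rfl
  · refine ⟨g, e, f, he, hf, ?_⟩
    convert hp using 1; group
  · refine ⟨g, -e, -f, by omega, by omega, ?_⟩
    have : g⁻¹ * (g * u'⁻¹ * g⁻¹) * g = u'⁻¹ := by group
    rw [this]
    unfold Pos at *
    rw [norm_inv_eq, es_inv, es_inv]
    linarith

theorem Pos.pow {e f : ℤ} {x : F2} (hx : Pos e f x) (n : ℕ) : Pos e f (x ^ n) := by
  induction n with
  | zero => simp [Pos, es_one]
  | succ n ih => rw [pow_succ]; exact ih.mul hx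

/-- syllable product -/
def sp (l : List (ℤ × ℤ)) : F2 := (l.map (fun a => t1 ^ a.1 * t2 ^ a.2)).prod

theorem toWord_zpow (i : Fin 2) (n : ℤ) : ∃ b, ((FreeGroup.of i) ^ n).toWord =
    List.replicate n.natAbs (i, b) := by
  obtain ⟨k, rfl | rfl⟩ := n.eq_nat_or_neg
  · exact ⟨true, by rw [zpow_natCast, toWord_of_pow]; simp⟩
  · refine ⟨false, ?_⟩
    rw [zpow_neg, toWord_inv, zpow_natCast, toWord_of_pow]
    simp [invRev]

/-- prepending a syllable -/
theorem norm_syl (i j : Fin 2) (hij : i ≠ j) (n : ℤ) (hn : n ≠ 0) (y : F2)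
    (hy : ∀ a ∈ y.toWord.head?, a.1 = j) :
    norm (FreeGroup.of i ^ n * y) = n.natAbs + norm y ∧
    ∀ a ∈ (FreeGroup.of i ^ n * y).toWord.head?, a.1 = i := by
  obtain ⟨b, hb⟩ := toWord_zpow i n
  have hr : IsReduced ((FreeGroup.of i ^ n).toWord ++ y.toWord) := by
    rw [IsReduced, List.isChain_append]
    refine ⟨isReduced_toWord, isReduced_toWord, ?_⟩
    intro x hx a ha
    have hx' := List.mem_of_mem_getLast? hx
    rw [hb] at hx'
    rw [List.eq_of_mem_replicate hx', hy a ha]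
    exact fun h => absurd h hij
  have hw : (FreeGroup.of i ^ n * y).toWord = (FreeGroup.of i ^ n).toWord ++ y.toWord := by
    rw [toWord_mul, hr.reduce_eq]
  constructor
  · unfold norm
    rw [hw, List.length_append, hb, List.length_replicate]
  · rw [hw, hb]
    obtain ⟨k, hk⟩ : ∃ k, n.natAbs = k + 1 := ⟨n.natAbs - 1, by omega⟩
    rw [hk]
    simp [List.replicate_succ]

theorem norm_sp (l : List (ℤ × ℤ)) (hl : ∀ a ∈ l, a.1 ≠ 0 ∧ a.2 ≠ 0) :
    (norm (sp l) : ℤ) = (l.map (fun a => |a.1| + |a.2|)).sum ∧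
    ∀ a ∈ (sp l).toWord.head?, a.1 = 0 := by
  induction l with
  | nil => simp [sp]
  | cons a l ih =>
    obtain ⟨i1, i2⟩ := ih (fun b hb => hl b (by simp [hb]))
    obtain ⟨ha1, ha2⟩ := hl a (by simp)
    have s1 := norm_syl 1 0 (by decide) a.2 ha2 (sp l) i2
    have s2 := norm_syl 0 1 (by decide) a.1 ha1 _ s1.2
    have e : sp (a :: l) = FreeGroup.of 0 ^ a.1 * (FreeGroup.of 1 ^ a.2 * sp l) := by
      simp [sp, t1, t2, mul_assoc]
    rw [e]
    refine ⟨?_, s2.2⟩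
    rw [s2.1, s1.1]
    push_cast
    rw [i1]
    simp [add_assoc]

theorem es_sp (l : List (ℤ × ℤ)) : es 0 (sp l) = (l.map (fun a => a.1)).sum ∧
    es 1 (sp l) = (l.map (fun a => a.2)).sum := by
  induction l with
  | nil => simp [sp, es_one]
  | cons a l ih =>
    have e : sp (a :: l) = t1 ^ a.1 * t2 ^ a.2 * sp l := by simp [sp]
    rw [e]
    simp [es_mul, es_zpow, es00, es01, es10, es11, ih]

theorem sp_pow (l : List (ℤ × ℤ)) (n : ℕ) : sp l ^ n = sp (List.replicate n l).flatten := by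
  induction n with
  | zero => simp [sp]
  | succ n ih =>
    rw [pow_succ', ih, List.replicate_succ]
    simp [sp]

theorem sp_bound (l : List (ℤ × ℤ)) (hl : ∀ a ∈ l, a.1 ≠ 0 ∧ a.2 ≠ 0) (g : F2) (e f : ℤ)
    (h : Pos e f (g⁻¹ * sp l * g)) :
    (l.map (fun a => |a.1| + |a.2|)).sum ≤ (l.map (fun a => e * a.1 + f * a.2)).sum := by
  have hs : (l.map (fun a => e * a.1 + f * a.2)).sum = e * es 0 (sp l) + f * es 1 (sp l) := by
    rw [(es_sp l).1, (es_sp l).2, List.sum_map_add, List.sum_map_mul_left, List.sum_map_mul_left]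
  rw [hs]
  set S := (l.map (fun a => |a.1| + |a.2|)).sum
  set Q := e * es 0 (sp l) + f * es 1 (sp l) with hQ
  have key : ∀ n : ℕ, n * S ≤ n * Q + 2 * norm g := by
    intro n
    have h1 := h.pow n
    have h2 : (g⁻¹ * sp l * g) ^ n = g⁻¹ * sp l ^ n * g := by
      have := conj_pow (i := n) (a := g⁻¹) (b := sp l)
      simpa using this
    rw [h2] at h1
    unfold Pos at h1
    have h3 : ∀ i, es i (g⁻¹ * sp l ^ n * g) = n * es i (sp l) := by
      intro i
      rw [es_mul, es_mul, es_inv, es_pow]; ring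
    rw [h3, h3] at h1
    have h4 : norm (sp l ^ n) ≤ norm g + norm (g⁻¹ * sp l ^ n * g) + norm g := by
      have a1 := norm_mul_le (g * (g⁻¹ * sp l ^ n * g)) g⁻¹
      have a2 := norm_mul_le g (g⁻¹ * sp l ^ n * g)
      have : g * (g⁻¹ * sp l ^ n * g) * g⁻¹ = sp l ^ n := by group
      rw [this, norm_inv_eq] at a1
      omega
    have h5 : (norm (sp l ^ n) : ℤ) = n * S := by
      rw [sp_pow, (norm_sp _ _).1]
      · simp [List.map_flatten, List.sum_flatten, S]
      · intro a ha
        simp at ha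
        exact hl a ha.2
    have h6 : (norm (sp l ^ n) : ℤ) ≤ norm g + norm (g⁻¹ * sp l ^ n * g) + norm g := by
      exact_mod_cast h4
    rw [hQ]
    nlinarith
  by_contra hcon
  push Not at hcon
  have := key (2 * norm g + 1)
  push_cast at this
  have hg : (0 : ℤ) ≤ norm g := by positivity
  nlinarith

end FreeGroup.Nielsen


/-- Nielsen's theorem: if `w = t₁^{α₁} t₂^{β₁} ⋯ t₁^{α_m} t₂^{β_m}` (a cyclically reduced
word, all `αᵢ ≠ 0`, `βᵢ ≠ 0`) is primitive, then all the `αᵢ` share the same sign and all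
the `βᵢ` share the same sign. -/
theorem stmt8 (m : ℕ) (hm : 1 ≤ m) (α β : Fin m → ℤ)
    (hα : ∀ i, α i ≠ 0) (hβ : ∀ i, β i ≠ 0)
    (hprim : Primitive ((List.ofFn (fun i : Fin m => t1 ^ α i * t2 ^ β i)).prod)) :
    ((∀ i, 0 < α i) ∨ (∀ i, α i < 0)) ∧ ((∀ i, 0 < β i) ∨ (∀ i, β i < 0)) := by
  classical
  have e0 : (List.ofFn (fun i : Fin m => t1 ^ α i * t2 ^ β i)).prod =
      FreeGroup.Nielsen.sp (List.ofFn (fun i => (α i, β i))) := by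
    simp [FreeGroup.Nielsen.sp, List.map_ofFn, Function.comp_def]
  rw [e0] at hprim
  obtain ⟨g, e, f, he, hf, hp⟩ := FreeGroup.Nielsen.primitive_pos hprim
  have hb := FreeGroup.Nielsen.sp_bound _ (by
    intro a ha
    rw [List.mem_ofFn] at ha
    obtain ⟨i, rfl⟩ := ha
    exact ⟨hα i, hβ i⟩) g e f hp
  simp only [List.map_ofFn, List.sum_ofFn, Function.comp_apply] at hb
  have hle : ∀ i ∈ Finset.univ, e * α i + f * β i ≤ |α i| + |β i| := by
    intro i _
    have a1 := le_abs_self (α i)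
    have a2 := neg_abs_le (α i)
    have a3 := le_abs_self (β i)
    have a4 := neg_abs_le (β i)
    rcases he with rfl | rfl <;> rcases hf with rfl | rfl <;> linarith
  have heq := (Finset.sum_eq_sum_iff_of_le hle).1 (le_antisymm (Finset.sum_le_sum hle) hb)
  have hsgn : ∀ i, 0 < e * α i ∧ 0 < f * β i := by
    intro i
    have h1 := heq i (Finset.mem_univ i)
    have a1 := le_abs_self (α i)
    have a2 := neg_abs_le (α i)
    have a3 := le_abs_self (β i)
    have a4 := neg_abs_le (β i)
    have b1 := abs_pos.2 (hα i)
    have b2 := abs_pos.2 (hβ i)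
    rcases he with rfl | rfl <;> rcases hf with rfl | rfl <;> constructor <;> linarith
  constructor
  · rcases he with rfl | rfl
    · left; intro i; have := (hsgn i).1; linarith
    · right; intro i; have := (hsgn i).1; linarith
  · rcases hf with rfl | rfl
    · left; intro i; have := (hsgn i).2; linarith
    · right; intro i; have := (hsgn i).2; linarith
end

section
/- Let F₂ be the free group on two generators and let (w₁, w₂) be a pair normally generating F₂. If both w₁ and w₂ are primitive elements of F₂, then there exist h₁, h₂ ∈ F₂ and an automorphism α of F₂ with w_i = h_i α(t_i) h_i⁻¹ for i = 1,2, where (t₁,t₂) is the standard basis (i.e., the pattern (w₁,w₂) is trivial). -/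
namespace NielsenProof

open FreeGroup

/-- Length of the longest common prefix of two lists. -/
def lcp : List (Fin 2 × Bool) → List (Fin 2 × Bool) → ℕ
  | a :: l, b :: m => if a = b then lcp l m + 1 else 0
  | _, _ => 0

theorem lcp_le_left : ∀ l m, lcp l m ≤ l.length
  | [], _ => by simp [lcp]
  | _ :: _, [] => by simp [lcp]
  | a :: l, b :: m => by
    have := lcp_le_left l m
    simp only [lcp, List.length_cons]
    split <;> omega

theorem lcp_ultra : ∀ l m n, min (lcp l m) (lcp m n) ≤ lcp l n
  | [], _, _ => by simp [lcp]
  | _ :: _, [], _ => by simp [lcp]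
  | _ :: _, _ :: _, [] => by simp [lcp]
  | a :: l, b :: m, c :: n => by
    have := lcp_ultra l m n
    simp only [lcp]
    split_ifs <;> grind

theorem reduce_lcp : ∀ l m : List (Fin 2 × Bool), IsReduced l → IsReduced m →
    (reduce (invRev l ++ m)).length + 2 * lcp l m = l.length + m.length
  | [], m => by
    intro _ h
    simp [lcp, h.reduce_eq]
  | a :: l, [] => by
    intro h _
    simp [lcp, reduce_invRev, h.reduce_eq]
  | a :: l, b :: m => by
    intro h1 h2
    by_cases hab : a = b
    · subst hab
      have h1' : IsReduced l := h1.infix ⟨[a], [], by simp⟩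
      have h2' : IsReduced m := h2.infix ⟨[a], [], by simp⟩
      have ih := reduce_lcp l m h1' h2'
      have e : reduce (invRev (a :: l) ++ a :: m) = reduce (invRev l ++ m) := by
        apply reduce.sound
        have e1 : mk (a :: l) = mk [a] * mk l := by rw [mul_mk]; rfl
        have e2 : mk (a :: m) = mk [a] * mk m := by rw [mul_mk]; rfl
        rw [← mul_mk, ← mul_mk, ← inv_mk, ← inv_mk, e1, e2]
        group
      rw [e]
      simp only [lcp, if_true, List.length_cons]
      omega
    · have hr : IsReduced (invRev (a :: l) ++ b :: m) := by
        have h1' : IsReduced (invRev (a :: l)) := by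
          rw [isReduced_iff_reduce_eq, reduce_invRev, h1.reduce_eq]
        refine List.isChain_append.2 ⟨h1', h2, ?_⟩
        rintro ⟨x1, x2⟩ hx ⟨y1, y2⟩ hy
        obtain ⟨a1, a2⟩ := a
        obtain ⟨b1, b2⟩ := b
        simp [invRev] at hx hy
        obtain ⟨rfl, rfl⟩ := hx
        obtain ⟨rfl, rfl⟩ := hy
        simp at hab ⊢
        intro e
        exact hab e
      rw [hr.reduce_eq]
      simp [lcp, hab]

/-- Integer length. -/
def len (x : F2) : ℤ := (FreeGroup.norm x : ℤ)

/-- Twice the Gromov product. -/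
def cc (x y : F2) : ℤ := len x + len y - len (x⁻¹ * y)

theorem cc_eq (x y : F2) : cc x y = 2 * (lcp x.toWord y.toWord : ℤ) := by
  have := reduce_lcp x.toWord y.toWord isReduced_toWord isReduced_toWord
  simp only [cc, len, FreeGroup.norm]
  rw [toWord_mul, toWord_inv]
  omega

theorem cc_even (x y : F2) : ∃ k, cc x y = 2 * k ∧ 0 ≤ k := ⟨_, cc_eq x y, by positivity⟩

theorem cc_ultra (x y z : F2) : min (cc x y) (cc y z) ≤ cc x z := by
  simp only [cc_eq]
  have := lcp_ultra x.toWord y.toWord z.toWord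
  omega

theorem len_inv (x : F2) : len x⁻¹ = len x := by simp [len]

theorem len_nonneg (x : F2) : 0 ≤ len x := by simp [len]

theorem len_mul (x y : F2) : len (x * y) ≤ len x + len y := by
  have := FreeGroup.norm_mul_le x y
  simp only [len]
  omega

theorem len_eq_zero {x : F2} (h : len x ≤ 0) : x = 1 := by
  rw [← FreeGroup.norm_eq_zero]
  simp only [len] at h
  omega

theorem cc_comm (x y : F2) : cc x y = cc y x := by
  have : len (y⁻¹ * x) = len (x⁻¹ * y) := by
    rw [← len_inv]
    congr 1
    group
  simp only [cc, this]
  ring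

theorem exists_prefix (y : F2) (n : ℕ) (hn : (n : ℤ) ≤ len y) :
    ∃ u : F2, len u = n ∧ len (u⁻¹ * y) = len y - n := by
  have hr : IsReduced y.toWord := isReduced_toWord
  have h1 : IsReduced (y.toWord.take n) := hr.infix (List.take_prefix _ _).isInfix
  have h2 : IsReduced (y.toWord.drop n) := hr.infix (List.drop_suffix _ _).isInfix
  refine ⟨mk (y.toWord.take n), ?_, ?_⟩
  · simp only [len, FreeGroup.norm, toWord_mk] at hn ⊢
    rw [h1.reduce_eq]
    simp at hn ⊢
    omega
  · have : (mk (y.toWord.take n))⁻¹ * y = mk (y.toWord.drop n) := by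
      rw [inv_mul_eq_iff_eq_mul, mul_mk, List.take_append_drop, mk_toWord]
    rw [this]
    simp only [len, FreeGroup.norm, toWord_mk] at hn ⊢
    rw [h2.reduce_eq]
    simp at hn ⊢
    omega

theorem len_sq {y : F2} (hy : y ≠ 1) : len y < len (y * y) := by
  have h := reduceCyclically.reduce_flatten_replicate_succ (isReduced_toWord (x := y)) 1
  have h0 := reduceCyclically.conj_conjugator_reduceCyclically y.toWord
  have h2 : (y * y).toWord = reduce (List.replicate (1 + 1) y.toWord).flatten := by
    rw [toWord_mul]; simp [List.replicate]
  have e1 := congrArg List.length h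
  have e0 := congrArg List.length h0
  have : (reduceCyclically y.toWord).length ≠ 0 := by
    intro hz
    rw [List.length_eq_zero_iff] at hz
    rw [hz] at h0
    apply hy
    rw [← mk_toWord (x := y), ← h0, ← mul_mk, ← mul_mk, ← inv_mk, ← one_eq_mk]
    group
  simp only [len, FreeGroup.norm]
  rw [h2]
  simp at e1 e0 ⊢
  omega

/-- Tie-breaking lemma. -/
theorem tie_inv {x y : F2} (hy : y ≠ 1) (h1 : cc x⁻¹ y = len y) (h2 : cc y⁻¹ x⁻¹ = len y) :
    False := by
  obtain ⟨k, hk, hk0⟩ := cc_even x⁻¹ y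
  obtain ⟨u, hu, hu'⟩ := exists_prefix y k.toNat (by omega)
  have cu : cc u y = len y := by simp only [cc]; omega
  have hv : len (y⁻¹ * u) = len (u⁻¹ * y) := by rw [← len_inv]; congr 1; group
  have cv : cc (y⁻¹ * u) y⁻¹ = len y := by
    simp only [cc]
    have : (y⁻¹ * u)⁻¹ * y⁻¹ = u⁻¹ := by group
    rw [this, len_inv, len_inv]
    omega
  have a1 := cc_ultra u y x⁻¹
  have a2 := cc_ultra (y⁻¹ * u) y⁻¹ x⁻¹
  have a3 := cc_ultra u x⁻¹ (y⁻¹ * u)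
  rw [cc_comm y x⁻¹] at a1
  rw [cc_comm x⁻¹ (y⁻¹ * u)] at a3
  have : len (u⁻¹ * (y⁻¹ * u)) ≤ 0 := by
    have : cc u (y⁻¹ * u) = len u + len (y⁻¹ * u) - len (u⁻¹ * (y⁻¹ * u)) := rfl
    omega
  have := len_eq_zero this
  apply hy
  have e : y = (u * (u⁻¹ * (y⁻¹ * u)) * u⁻¹)⁻¹ := by group
  rw [e, this]
  group

theorem tie_same {x y : F2} (hy : y ≠ 1) (hxy : len y ≤ len x)
    (h1 : cc x⁻¹ y = len y) (h2 : cc y⁻¹ x = len y) :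
    ∃ u : F2, len (u⁻¹ * y * u) + len (u⁻¹ * (y * x) * u) < len x + len y := by
  obtain ⟨k, hk, hk0⟩ := cc_even x⁻¹ y
  obtain ⟨u, hu, hu'⟩ := exists_prefix y k.toNat (by omega)
  have hypos : 0 < len y := by
    by_contra h
    exact hy (len_eq_zero (by omega))
  have cu : cc u y = len y := by simp only [cc]; omega
  set v := y⁻¹ * u with hvdef
  have hv : len v = len (u⁻¹ * y) := by rw [← len_inv, hvdef]; congr 1; group
  have cv : cc v y⁻¹ = len y := by
    simp only [cc]
    have : v⁻¹ * y⁻¹ = u⁻¹ := by rw [hvdef]; group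
    rw [this, len_inv, len_inv]
    omega
  have a1 := cc_ultra u y x⁻¹
  have a2 := cc_ultra v y⁻¹ x
  rw [cc_comm y x⁻¹] at a1
  have b1 : cc u x⁻¹ = len u + len x - len (x * u) := by
    simp only [cc]
    have : len (u⁻¹ * x⁻¹) = len (x * u) := by rw [← len_inv]; congr 1; group
    rw [this, len_inv]
  have a3 := cc_ultra v x (x * u)
  have b2 : cc x (x * u) = len x + len (x * u) - len u := by
    simp only [cc]
    congr 2
    group
  have b3 : cc v (x * u) = len v + len (x * u) - len (v⁻¹ * (x * u)) := rfl
  have b4 : len (x * u) ≥ len x - len u := by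
    have := len_mul (x * u) u⁻¹
    rw [len_inv] at this
    have e : x * u * u⁻¹ = x := by group
    rw [e] at this
    omega
  refine ⟨u, ?_⟩
  have e1 : u⁻¹ * y * u = (u⁻¹ * y) * u := rfl
  have e2 : u⁻¹ * (y * x) * u = v⁻¹ * (x * u) := by rw [hvdef]; group
  rw [e2]
  have := len_mul (u⁻¹ * y) u
  omega

/-- Predicates on pairs closed under Nielsen moves and simultaneous conjugation. -/
structure Closed (P : F2 → F2 → Prop) : Prop where
  swap : ∀ x y, P x y → P y x
  inv : ∀ x y, P x y → P x⁻¹ y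
  mul : ∀ x y, P x y → P x (x * y)
  conj : ∀ g x y, P x y → P (g * x * g⁻¹) (g * y * g⁻¹)

theorem Closed.inv2 {P} (h : Closed P) (x y : F2) (hp : P x y) : P x y⁻¹ :=
  h.swap _ _ (h.inv _ _ (h.swap _ _ hp))

theorem Closed.of_inv {P} (h : Closed P) (x y : F2) (hp : P x⁻¹ y) : P x y := by
  simpa using h.inv _ _ hp

theorem Closed.of_inv2 {P} (h : Closed P) (x y : F2) (hp : P x y⁻¹) : P x y := by
  simpa using h.inv2 _ _ hp

theorem Closed.of_mul {P} (h : Closed P) (x y : F2) (hp : P x (x * y)) : P x y := by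
  have := h.of_inv _ _ (h.mul _ _ (h.inv _ _ hp))
  simpa using this

theorem Closed.of_conj {P} (h : Closed P) (g x y : F2) (hp : P (g⁻¹ * x * g) (g⁻¹ * y * g)) :
    P x y := by
  have := h.conj g _ _ hp
  have e : ∀ x : F2, g * (g⁻¹ * x * g) * g⁻¹ = x := by intro x; group
  rwa [e, e] at this

/-- Generating pairs. -/
def Gen (x y : F2) : Prop := Subgroup.closure ({x, y} : Set F2) = ⊤

theorem gen_iff (x y : F2) : Gen x y ↔ ∀ H : Subgroup F2, x ∈ H → y ∈ H → ∀ g, g ∈ H := by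
  constructor
  · intro h H hx hy g
    have : Subgroup.closure ({x, y} : Set F2) ≤ H := by
      rw [Subgroup.closure_le]
      rintro a (rfl | rfl) <;> assumption
    rw [h] at this
    exact this trivial
  · intro h
    rw [Gen, eq_top_iff]
    intro g _
    exact h _ (Subgroup.subset_closure (by simp)) (Subgroup.subset_closure (by simp)) g

theorem gen_closed : Closed Gen where
  swap x y h := by
    rw [gen_iff] at *
    intro H hx hy
    exact h H hy hx
  inv x y h := by
    rw [gen_iff] at *
    intro H hx hy
    exact h H (by simpa using hx) hy
  mul x y h := by
    rw [gen_iff] at *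
    intro H hx hy
    exact h H hx (by simpa [H.mul_mem_cancel_left hx] using hy)
  conj g x y h := by
    rw [gen_iff] at *
    intro H hx hy a
    have := h (H.comap (MulAut.conj g).toMonoidHom) (by simpa using hx) (by simpa using hy)
      (g⁻¹ * a * g)
    simp only [Subgroup.mem_comap] at this
    convert this using 1
    simp [mul_assoc]

theorem t_ne : t1 * t2 ≠ t2 * t1 := by decide

theorem gen_ne_one {x y : F2} (h : Gen x y) : y ≠ 1 := by
  rintro rfl
  rw [gen_iff] at h
  have h1 := h (Subgroup.zpowers x) (by simp) (one_mem _)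
  obtain ⟨m, hm⟩ := h1 t1
  obtain ⟨n, hn⟩ := h1 t2
  apply t_ne
  simp only at hm hn
  rw [← hm, ← hn, ← zpow_add, ← zpow_add, add_comm]

theorem cc_self {y : F2} (h : y ≠ 1) : cc y⁻¹ y < len y := by
  have := len_sq h
  simp only [cc, inv_inv, len_inv]
  omega

/-- Minimal counterexamples. -/
structure Bad (P : F2 → F2 → Prop) (N : ℤ) (x y : F2) : Prop where
  gen : Gen x y
  npos : ¬ P x y
  size : len x + len y = N

section
variable {P : F2 → F2 → Prop} {N : ℤ} (hP : Closed P)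
  (ih : ∀ x y, Gen x y → len x + len y < N → P x y)

section
include hP

theorem Bad.swap {x y : F2} (h : Bad P N x y) : Bad P N y x :=
  ⟨gen_closed.swap _ _ h.gen, fun h' => h.npos (hP.swap _ _ h'), by have := h.size; omega⟩

theorem Bad.inv {x y : F2} (h : Bad P N x y) : Bad P N x⁻¹ y :=
  ⟨gen_closed.inv _ _ h.gen, fun h' => h.npos (hP.of_inv _ _ h'),
    by have := h.size; rw [len_inv]; omega⟩

theorem Bad.inv2 {x y : F2} (h : Bad P N x y) : Bad P N x y⁻¹ :=
  Bad.swap hP (Bad.inv hP (Bad.swap hP h))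

end

include hP ih

theorem Bad.len1 {x y : F2} (h : Bad P N x y) : len y ≤ len (x * y) := by
  by_contra hc
  apply h.npos
  apply hP.of_mul
  apply ih _ _ (gen_closed.mul _ _ h.gen)
  have := h.size
  omega

theorem Bad.len2 {x y : F2} (h : Bad P N x y) : len x ≤ len (x * y) := by
  have := Bad.len1 hP ih (Bad.inv hP (Bad.inv2 hP (Bad.swap hP h)))
  rw [← mul_inv_rev, len_inv, len_inv] at this
  exact this

theorem Bad.cc1 {x y : F2} (h : Bad P N x y) : cc x⁻¹ y ≤ len x ∧ cc x⁻¹ y ≤ len y := by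
  have h1 := Bad.len1 hP ih h
  have h2 := Bad.len2 hP ih h
  simp only [cc, inv_inv, len_inv]
  omega

theorem Bad.tie1 {x y : F2} (h : Bad P N x y) : cc x⁻¹ y + cc y⁻¹ x < 2 * len y := by
  have h1 := Bad.cc1 hP ih h
  have h2 := Bad.cc1 hP ih (Bad.swap hP h)
  by_contra hc
  obtain ⟨u, hu⟩ := tie_same (x := x) (y := y) (gen_ne_one h.gen) (by omega) (by omega) (by omega)
  apply h.npos
  apply hP.swap
  apply hP.of_mul
  apply hP.of_conj u
  apply ih
  · have := gen_closed.conj u⁻¹ _ _ (gen_closed.mul _ _ (gen_closed.swap _ _ h.gen))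
    simpa using this
  · have := h.size
    omega

theorem Bad.tie2 {x y : F2} (h : Bad P N x y) : cc x⁻¹ y + cc y⁻¹ x⁻¹ < 2 * len y := by
  have h1 := Bad.cc1 hP ih h
  have h2 := Bad.cc1 hP ih (Bad.inv2 hP (Bad.swap hP h))
  by_contra hc
  exact tie_inv (x := x) (y := y) (gen_ne_one h.gen) (by omega) (by omega)

end

/-- The four signed generators. -/
def LL (w z : F2) : Set F2 := {w, w⁻¹, z, z⁻¹}

/-- Reduced products, with last letter. -/
inductive RP (w z : F2) : F2 → F2 → Prop
  | single (x : F2) (hx : x ∈ LL w z) : RP w z x x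
  | snoc (g x y : F2) (hg : RP w z g x) (hy : y ∈ LL w z) (hxy : x * y ≠ 1) : RP w z (g * y) y

theorem RP.mem {w z g x : F2} (h : RP w z g x) : x ∈ LL w z := by
  cases h <;> assumption

theorem RP.mul {w z g : F2} (h : g = 1 ∨ ∃ x, RP w z g x) {y : F2} (hy : y ∈ LL w z) :
    g * y = 1 ∨ ∃ x, RP w z (g * y) x := by
  rcases h with rfl | ⟨x, h⟩
  · right
    exact ⟨y, by simpa using RP.single y hy⟩
  · by_cases hxy : x * y = 1
    · have hy' : y = x⁻¹ := (inv_eq_of_mul_eq_one_right hxy).symm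
      subst hy'
      cases h with
      | single _ hx => left; simp
      | snoc g x' _ hg hx _ => right; exact ⟨x', by simpa using hg⟩
    · right
      exact ⟨y, RP.snoc _ _ _ h hy hxy⟩

theorem RP.all {w z : F2} (h : Gen w z) (g : F2) : g = 1 ∨ ∃ x, RP w z g x := by
  have hg : g ∈ Subgroup.closure ({w, z} : Set F2) := by rw [h]; trivial
  induction hg using Subgroup.closure_induction_right with
  | one => left; rfl
  | mul_right x hx y hy ih =>
    apply RP.mul ih
    rcases hy with rfl | rfl <;> simp [LL]
  | mul_inv_cancel x hx y hy ih =>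
    apply RP.mul ih
    rcases hy with rfl | rfl <;> simp [LL]

section
variable {P : F2 → F2 → Prop} {N : ℤ} (hP : Closed P)
  (ih : ∀ x y, Gen x y → len x + len y < N → P x y) {w z : F2} (hb : Bad P N w z)

include hP hb

theorem LL_adj {p q : F2} (hp : p ∈ LL w z) (hq : q ∈ LL w z) (hpq : p * q ≠ 1) :
    p = q ∨ (Bad P N p q ∧ ∀ r ∈ LL w z, r = p ∨ r = p⁻¹ ∨ r = q ∨ r = q⁻¹) := by
  have b1 := hb
  have b2 := Bad.inv hP b1
  have b3 := Bad.inv2 hP b1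
  have b4 := Bad.inv2 hP b2
  have c1 := Bad.swap hP b1
  have c2 := Bad.swap hP b2
  have c3 := Bad.swap hP b3
  have c4 := Bad.swap hP b4
  simp only [LL, Set.mem_insert_iff, Set.mem_singleton_iff] at *
  rcases hp with rfl | rfl | rfl | rfl <;> rcases hq with rfl | rfl | rfl | rfl <;>
    first
    | (exact Or.inl rfl)
    | (refine Or.inr ⟨by assumption, ?_⟩
       intro r hr
       try simp only [inv_inv]
       tauto)
    | (exact absurd (by group) hpq)

theorem LL_ne {q : F2} (hq : q ∈ LL w z) : q ≠ 1 := by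
  have b1 := gen_ne_one hb.gen
  have b2 := gen_ne_one (gen_closed.swap _ _ hb.gen)
  simp only [LL, Set.mem_insert_iff, Set.mem_singleton_iff] at *
  rcases hq with rfl | rfl | rfl | rfl <;> simpa

include ih

theorem LL_cc {p q : F2} (hp : p ∈ LL w z) (hq : q ∈ LL w z) (hpq : p * q ≠ 1) :
    cc p⁻¹ q ≤ len p ∧ cc p⁻¹ q ≤ len q := by
  rcases LL_adj hP hb hp hq hpq with rfl | ⟨h, -⟩
  · have := cc_self (LL_ne hP hb hp)
    omega
  · exact Bad.cc1 hP ih h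

theorem LL_triple {p q r : F2} (hp : p ∈ LL w z) (hq : q ∈ LL w z) (hr : r ∈ LL w z)
    (hpq : p * q ≠ 1) (hqr : q * r ≠ 1) : cc p⁻¹ q + cc q⁻¹ r < 2 * len q := by
  have hs := cc_self (LL_ne hP hb hq)
  rcases LL_adj hP hb hp hq hpq with rfl | ⟨h, h'⟩
  · have := (LL_cc hP ih hb hq hr hqr).1
    omega
  · rcases h' r hr with rfl | rfl | rfl | rfl
    · exact Bad.tie1 hP ih h
    · exact Bad.tie2 hP ih h
    · have := (LL_cc hP ih hb hp hq hpq).2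
      omega
    · simp at hqr

theorem RP_inv {g x : F2} (h : RP w z g x) :
    (∀ y ∈ LL w z, x * y ≠ 1 → cc g⁻¹ y = cc x⁻¹ y) ∧
    (g = x ∨ ∃ p ∈ LL w z, p * x ≠ 1 ∧ 2 * len x - cc p⁻¹ x + 2 ≤ 2 * len g) := by
  induction h with
  | single x hx => exact ⟨fun _ _ _ => rfl, Or.inl rfl⟩
  | snoc g x y hg hy hxy IH =>
    have hx := hg.mem
    have hc := IH.1 y hy hxy
    have hl : cc g⁻¹ y = len g + len y - len (g * y) := by simp [cc, len_inv]
    have hcc := LL_cc hP ih hb hx hy hxy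
    constructor
    · intro r hr hyr
      have ht := LL_triple hP ih hb hx hy hr hxy hyr
      have e : cc (g * y)⁻¹ y⁻¹ = len (g * y) + len y - len g := by
        rw [cc, len_inv, len_inv]
        simp
      have u1 := cc_ultra (g * y)⁻¹ y⁻¹ r
      have u2 := cc_ultra y⁻¹ (g * y)⁻¹ r
      rw [cc_comm y⁻¹ (g * y)⁻¹] at u2
      omega
    · right
      refine ⟨x, hx, hxy, ?_⟩
      rcases IH.2 with rfl | ⟨p, hp, hpx, hlen⟩
      · obtain ⟨k, hk, -⟩ := cc_even g⁻¹ y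
        have : 0 < len g := by
          by_contra hh
          exact LL_ne hP hb hx (len_eq_zero (by omega))
        omega
      · have ht := LL_triple hP ih hb hp hx hy hpx hxy
        omega

theorem mem_LL_of_len {g : F2} (hg : len g = 1) : g ∈ LL w z := by
  rcases RP.all hb.gen g with rfl | ⟨x, h⟩
  · simp [len] at hg
  · rcases (RP_inv hP ih hb h).2 with rfl | ⟨p, hp, hpx, hl⟩
    · exact h.mem
    · have := LL_cc hP ih hb hp h.mem hpx
      have : 0 < len x := by
        by_contra hh
        exact LL_ne hP hb h.mem (len_eq_zero (by omega))
      omega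

theorem bad_false (base : P t1 t2) : False := by
  have h1 : t1 ∈ LL w z := mem_LL_of_len hP ih hb (by simp [len, t1])
  have h2 : t2 ∈ LL w z := mem_LL_of_len hP ih hb (by simp [len, t2])
  have hne := t_ne
  apply hb.npos
  simp only [LL, Set.mem_insert_iff, Set.mem_singleton_iff] at h1 h2
  rcases h1 with h1 | h1 | h1 | h1 <;> rcases h2 with h2 | h2 | h2 | h2 <;>
    rw [h1, h2] at base hne <;>
    first
    | exact base
    | exact hP.swap _ _ base
    | exact hP.of_inv _ _ base
    | exact hP.of_inv2 _ _ base
    | exact hP.of_inv _ _ (hP.of_inv2 _ _ base)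
    | exact hP.of_inv _ _ (hP.swap _ _ base)
    | exact hP.of_inv2 _ _ (hP.swap _ _ base)
    | exact hP.of_inv _ _ (hP.of_inv2 _ _ (hP.swap _ _ base))
    | exact absurd (by group) hne

end

/-- Nielsen: every generating pair is reached from the standard one. -/
theorem nielsen {P : F2 → F2 → Prop} (hP : Closed P) (base : P t1 t2) :
    ∀ (n : ℕ) (w z : F2), len w + len z = n → Gen w z → P w z := by
  intro n
  induction n using Nat.strong_induction_on with
  | _ n IH =>
    intro w z hn hg
    by_contra hc
    refine bad_false (N := n) hP ?_ ⟨hg, hc, hn⟩ base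
    intro x y hxy hl
    have := len_nonneg x
    have := len_nonneg y
    exact IH (len x + len y).toNat (by omega) x y (by omega) hxy

theorem nielsen' {P : F2 → F2 → Prop} (hP : Closed P) (base : P t1 t2) {w z : F2}
    (h : Gen w z) : P w z := by
  have := len_nonneg w
  have := len_nonneg z
  exact nielsen hP base (len w + len z).toNat w z (by omega) h

/-- The homomorphism from `F2` with prescribed values on the basis. -/
def hom2 {G : Type*} [Group G] (x y : G) : F2 →* G := FreeGroup.lift ![x, y]

@[simp] theorem hom2_t1 {G : Type*} [Group G] (x y : G) : hom2 x y t1 = x := by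
  simp [hom2, t1]

@[simp] theorem hom2_t2 {G : Type*} [Group G] (x y : G) : hom2 x y t2 = y := by
  simp [hom2, t2]

theorem hom_ext {G : Type*} [Group G] {f g : F2 →* G} (h1 : f t1 = g t1) (h2 : f t2 = g t2) :
    f = g := by
  apply FreeGroup.ext_hom
  intro i
  fin_cases i
  · exact h1
  · exact h2

theorem exists_aut (x y x' y' : F2) (h1 : hom2 x y x' = t1) (h2 : hom2 x y y' = t2)
    (h3 : hom2 x' y' x = t1) (h4 : hom2 x' y' y = t2) :
    ∃ α : F2 ≃* F2, (α t1 = x ∧ α t2 = y) ∧ α.symm.toMonoidHom = hom2 x' y' := by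
  refine ⟨MonoidHom.toMulEquiv (hom2 x y) (hom2 x' y') ?_ ?_, ⟨?_, ?_⟩, ?_⟩
  · exact hom_ext (by simpa using h3) (by simpa using h4)
  · exact hom_ext (by simpa using h1) (by simpa using h2)
  · simp
  · simp
  · rfl

/-- Bases. -/
def Bas (x y : F2) : Prop := ∃ α : F2 ≃* F2, α t1 = x ∧ α t2 = y

theorem bas_closed : Closed Bas where
  swap := by
    rintro x y ⟨α, rfl, rfl⟩
    obtain ⟨β, ⟨h1, h2⟩, -⟩ := exists_aut t2 t1 t2 t1 (by simp) (by simp) (by simp) (by simp)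
    exact ⟨β.trans α, by simp [h1], by simp [h2]⟩
  inv := by
    rintro x y ⟨α, rfl, rfl⟩
    obtain ⟨β, ⟨h1, h2⟩, -⟩ := exists_aut t1⁻¹ t2 t1⁻¹ t2 (by simp) (by simp) (by simp) (by simp)
    exact ⟨β.trans α, by simp [h1], by simp [h2]⟩
  mul := by
    rintro x y ⟨α, rfl, rfl⟩
    obtain ⟨β, ⟨h1, h2⟩, -⟩ :=
      exists_aut t1 (t1 * t2) t1 (t1⁻¹ * t2) (by simp) (by simp) (by simp) (by simp)
    exact ⟨β.trans α, by simp [h1], by simp [h2]⟩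
  conj := by
    rintro g x y ⟨α, rfl, rfl⟩
    exact ⟨α.trans (MulAut.conj g), by simp, by simp⟩

/-- Positive pairs (up to the choice of signs of the letters). -/
inductive SS (a b : F2) : F2 → F2 → Prop
  | base : SS a b a b
  | swap (x y) : SS a b x y → SS a b y x
  | mul (x y) : SS a b x y → SS a b x (x * y)

/-- Choices of signs. -/
def Sgn (a b : F2) : Prop := (a = t1 ∨ a = t1⁻¹) ∧ (b = t2 ∨ b = t2⁻¹)

/-- Pairs conjugate to signed positive pairs. -/
def TT (w z : F2) : Prop := ∃ a b g x y, Sgn a b ∧ SS a b x y ∧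
  (w = g * x * g⁻¹ ∨ w = g * x⁻¹ * g⁻¹) ∧ (z = g * y * g⁻¹ ∨ z = g * y⁻¹ * g⁻¹)

theorem TT_swap (w z : F2) (h : TT w z) : TT z w := by
  obtain ⟨a, b, g, x, y, h0, h1, h2, h3⟩ := h
  exact ⟨a, b, g, y, x, h0, .swap _ _ h1, h3, h2⟩

theorem TT_inv (w z : F2) (h : TT w z) : TT w⁻¹ z := by
  obtain ⟨a, b, g, x, y, h0, h1, h2, h3⟩ := h
  refine ⟨a, b, g, x, y, h0, h1, ?_, h3⟩
  rcases h2 with rfl | rfl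
  · right; group
  · left; group

theorem TT_inv2 (w z : F2) (h : TT w z) : TT w z⁻¹ :=
  TT_swap _ _ (TT_inv _ _ (TT_swap _ _ h))

theorem TT_conj (k w z : F2) (h : TT w z) : TT (k * w * k⁻¹) (k * z * k⁻¹) := by
  obtain ⟨a, b, g, x, y, h0, h1, h2, h3⟩ := h
  refine ⟨a, b, k * g, x, y, h0, h1, ?_, ?_⟩
  · rcases h2 with rfl | rfl
    · left; group
    · right; group
  · rcases h3 with rfl | rfl
    · left; group
    · right; group

theorem TT_of_SS {a b x y : F2} (h0 : Sgn a b) (h : SS a b x y) : TT x y :=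
  ⟨a, b, 1, x, y, h0, h, by simp, by simp⟩

theorem TT_congr {w z w' z' : F2} (h : TT w z) (h1 : w = w') (h2 : z = z') : TT w' z' := by
  subst h1; subst h2; exact h

theorem TT_neg {a b x y : F2} (h0 : Sgn a b) (h : SS a b x y) :
    TT x (x⁻¹ * y) ∧ TT y (y⁻¹ * x) := by
  induction h with
  | base =>
    have s1 : Sgn a⁻¹ b := by
      obtain ⟨rfl | rfl, h⟩ := h0 <;> exact ⟨by simp, h⟩
    have s2 : Sgn a b⁻¹ := by
      obtain ⟨h, rfl | rfl⟩ := h0 <;> exact ⟨h, by simp⟩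
    constructor
    · have := TT_inv _ _ (TT_of_SS s1 (.mul _ _ .base))
      simpa using this
    · have := TT_inv _ _ (TT_of_SS s2 (.mul _ _ (.swap _ _ .base)))
      simpa using this
  | swap x y _ ih => exact ih.symm
  | mul x y h ih =>
    constructor
    · have := TT_of_SS h0 h
      simpa using this
    · have := TT_of_SS h0 (.swap _ _ (.mul _ _ (.swap _ _ h)))
      have := TT_inv2 _ _ (TT_conj y⁻¹ _ _ this)
      exact TT_congr this (by group) (by group)

theorem TT_mul (w z : F2) (h : TT w z) : TT w (w * z) := by
  obtain ⟨a, b, g, x, y, h0, h1, h2, h3⟩ := h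
  have p := TT_of_SS h0 (.mul _ _ h1)
  have n := (TT_neg h0 h1).1
  rcases h2 with rfl | rfl
  · rcases h3 with rfl | rfl
    · exact TT_congr (TT_conj g _ _ p) (by group) (by group)
    · exact TT_congr (TT_conj g _ _ (TT_conj x _ _ (TT_inv2 _ _ n))) (by group) (by group)
  · rcases h3 with rfl | rfl
    · exact TT_congr (TT_conj g _ _ (TT_inv _ _ n)) (by group) (by group)
    · exact TT_congr (TT_conj g _ _ (TT_conj x⁻¹ _ _ (TT_inv _ _ (TT_inv2 _ _ p))))
        (by group) (by group)

theorem TT_closed : Closed TT := ⟨TT_swap, TT_inv, TT_mul, TT_conj⟩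

theorem TT_base : TT t1 t2 := TT_of_SS (a := t1) (b := t2) ⟨by simp, by simp⟩ .base

/-- Exponent sums. -/
def expA : F2 →* Multiplicative ℤ := hom2 (Multiplicative.ofAdd 1) 1
/-- Exponent sums. -/
def expB : F2 →* Multiplicative ℤ := hom2 1 (Multiplicative.ofAdd 1)

/-- Exponent sum of the first generator. -/
def eA (x : F2) : ℤ := (expA x).toAdd
/-- Exponent sum of the second generator. -/
def eB (x : F2) : ℤ := (expB x).toAdd

theorem eA_mul (x y : F2) : eA (x * y) = eA x + eA y := by simp [eA]
theorem eB_mul (x y : F2) : eB (x * y) = eB x + eB y := by simp [eB]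
theorem eA_inv (x : F2) : eA x⁻¹ = - eA x := by simp [eA]
theorem eB_inv (x : F2) : eB x⁻¹ = - eB x := by simp [eB]
theorem eB_zpow (x : F2) (n : ℤ) : eB (x ^ n) = n * eB x := by simp [eB]
theorem eA_t1 : eA t1 = 1 := by simp [eA, expA]
theorem eA_t2 : eA t2 = 0 := by simp [eA, expA]
theorem eB_t1 : eB t1 = 0 := by simp [eB, expB]
theorem eB_t2 : eB t2 = 1 := by simp [eB, expB]

theorem SS_pos {a b x y : F2} (h0 : Sgn a b) (h : SS a b x y) :
    ((∃ n : ℤ, x = t2 ^ n) ∨ 0 < eA a * eA x) ∧ ((∃ n : ℤ, y = t2 ^ n) ∨ 0 < eA a * eA y) := by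
  induction h with
  | base =>
    obtain ⟨ha, hb⟩ := h0
    constructor
    · right
      rcases ha with rfl | rfl <;> simp [eA_inv, eA_t1]
    · left
      rcases hb with rfl | rfl
      · exact ⟨1, by simp⟩
      · exact ⟨-1, by simp⟩
  | swap x y _ ih => exact ih.symm
  | mul x y _ ih =>
    refine ⟨ih.1, ?_⟩
    have key : ∀ n : ℤ, eA (t2 ^ n) = 0 := by
      intro n
      simp [eA, expA]
    rw [eA_mul, mul_add]
    rcases ih with ⟨⟨n, rfl⟩ | h1, ⟨m, rfl⟩ | h2⟩
    · left; exact ⟨n + m, by rw [zpow_add]⟩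
    · right; rw [key]; simpa using h2
    · right; rw [key]; simpa using h1
    · right; positivity

theorem conj_t2 {w : F2} (hw : Primitive w) (hA : eA w = 0) (hB : eB w = 1) :
    ∃ g : F2, w = g * t2 * g⁻¹ := by
  obtain ⟨z, hz⟩ := hw
  obtain ⟨a, b, g, x, y, h0, h1, h2, -⟩ := nielsen' TT_closed TT_base (w := w) (z := z) hz
  have hx : eA x = 0 := by
    rcases h2 with rfl | rfl <;> simp only [eA_mul, eA_inv] at hA <;> omega
  have : ∃ n : ℤ, x = t2 ^ n := by
    rcases (SS_pos h0 h1).1 with h | h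
    · exact h
    · rw [hx] at h; simp at h
  obtain ⟨n, rfl⟩ := this
  refine ⟨g, ?_⟩
  rcases h2 with rfl | rfl
  · simp only [eB_mul, eB_inv, eB_zpow, eB_t2] at hB
    have : n = 1 := by omega
    subst this
    simp
  · simp only [eB_mul, eB_inv, eB_zpow, eB_t2] at hB
    have : n = -1 := by omega
    subst this
    simp

theorem Primitive_map {w : F2} (hw : Primitive w) (α : F2 ≃* F2) : Primitive (α w) := by
  obtain ⟨z, hz⟩ := hw
  refine ⟨α z, ?_⟩
  have := congrArg (Subgroup.map α.toMonoidHom) hz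
  rw [MonoidHom.map_closure, Set.image_pair] at this
  rw [Subgroup.map_top_of_surjective _ α.surjective] at this
  exact this

theorem eB_unit {v : F2} (h : Subgroup.normalClosure ({t1, v} : Set F2) = ⊤) :
    eB v = 1 ∨ eB v = -1 := by
  have : Subgroup.normalClosure ({t1, v} : Set F2) ≤
      (Subgroup.zpowers (expB v)).comap expB := by
    apply Subgroup.normalClosure_le_normal
    rintro x (rfl | rfl)
    · simp [expB]
    · simp
  rw [h] at this
  obtain ⟨n, hn⟩ := this (Subgroup.mem_top t2)
  have h2 := congrArg Multiplicative.toAdd hn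
  simp only [toAdd_zpow, smul_eq_mul] at h2
  change n * eB v = eB t2 at h2
  rw [eB_t2, mul_comm] at h2
  exact Int.isUnit_iff.1 (IsUnit.of_mul_eq_one _ h2)

theorem exp_formula (f : F2 →* Multiplicative ℤ) (v : F2) :
    (f v).toAdd = eA v * (f t1).toAdd + eB v * (f t2).toAdd := by
  let k : F2 →* Multiplicative ℤ := MonoidHom.mk' (fun v => f t1 ^ eA v * f t2 ^ eB v) (by
    intro x y
    simp only [eA_mul, eB_mul, zpow_add]
    exact mul_mul_mul_comm _ _ _ _)
  have hk : f = k := by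
    apply hom_ext
    · simp [k, eA_t1, eB_t1]
    · simp [k, eA_t2, eB_t2]
  have := DFunLike.congr_fun hk v
  rw [this]
  simp [k]

theorem std_case {v : F2} (hv : Primitive v)
    (h : Subgroup.normalClosure ({t1, v} : Set F2) = ⊤) :
    ∃ (g : F2) (β : F2 ≃* F2), β t1 = t1 ∧ v = g * β t2 * g⁻¹ := by
  have he := eB_unit h
  have hb : ∃ β : F2 ≃* F2, β t1 = t1 ∧ eA (β.symm v) = 0 ∧ eB (β.symm v) = 1 := by
    rcases he with he | he
    · obtain ⟨β, ⟨h1, -⟩, h2⟩ := exists_aut t1 (t1 ^ (eA v) * t2) t1 (t1 ^ (- eA v) * t2)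
        (by simp) (by simp) (by simp) (by simp)
      refine ⟨β, h1, ?_, ?_⟩
      · have := exp_formula (expA.comp β.symm.toMonoidHom) v
        rw [h2] at this
        have e : eA (β.symm v) = ((expA.comp (hom2 t1 (t1 ^ (- eA v) * t2))) v).toAdd := by
          rw [← h2]; rfl
        rw [e, this]
        simp [expA, he]
      · have := exp_formula (expB.comp β.symm.toMonoidHom) v
        rw [h2] at this
        have e : eB (β.symm v) = ((expB.comp (hom2 t1 (t1 ^ (- eA v) * t2))) v).toAdd := by
          rw [← h2]; rfl
        rw [e, this]
        simp [expB, he]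
    · obtain ⟨β, ⟨h1, -⟩, h2⟩ := exists_aut t1 (t1 ^ (eA v) * t2⁻¹) t1 (t2⁻¹ * t1 ^ (eA v))
        (by simp) (by simp) (by simp) (by simp)
      refine ⟨β, h1, ?_, ?_⟩
      · have := exp_formula (expA.comp β.symm.toMonoidHom) v
        rw [h2] at this
        have e : eA (β.symm v) = ((expA.comp (hom2 t1 (t2⁻¹ * t1 ^ (eA v)))) v).toAdd := by
          rw [← h2]; rfl
        rw [e, this]
        simp [expA, he]
      · have := exp_formula (expB.comp β.symm.toMonoidHom) v
        rw [h2] at this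
        have e : eB (β.symm v) = ((expB.comp (hom2 t1 (t2⁻¹ * t1 ^ (eA v)))) v).toAdd := by
          rw [← h2]; rfl
        rw [e, this]
        simp [expB, he]
  obtain ⟨β, h1, hA, hB⟩ := hb
  obtain ⟨g, hg⟩ := conj_t2 (Primitive_map hv β.symm) hA hB
  refine ⟨β g, β, h1, ?_⟩
  have := congrArg β hg
  simpa using this

end NielsenProof

/-- If `(w₁, w₂)` normally generates `F₂` and both `w₁` and `w₂` are primitive, then the
pattern `(w₁, w₂)` is trivial: there are `h₁, h₂ ∈ F₂` and `α ∈ Aut(F₂)` with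
`wᵢ = hᵢ α(tᵢ) hᵢ⁻¹`. -/
theorem stmt12 (w₁ w₂ : F2)
    (h : Subgroup.normalClosure ({w₁, w₂} : Set F2) = ⊤)
    (h₁ : Primitive w₁) (h₂ : Primitive w₂) :
    ∃ (g₁ g₂ : F2) (α : F2 ≃* F2),
      w₁ = g₁ * α t1 * g₁⁻¹ ∧ w₂ = g₂ * α t2 * g₂⁻¹ := by
  obtain ⟨z, hz⟩ := h₁
  obtain ⟨α, hα, -⟩ := NielsenProof.nielsen' NielsenProof.bas_closed
    ⟨MulEquiv.refl _, rfl, rfl⟩ (w := w₁) (z := z) hz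
  have hn : Subgroup.normalClosure ({t1, α.symm w₂} : Set F2) = ⊤ := by
    have := congrArg (Subgroup.map α.symm.toMonoidHom) h
    rw [Subgroup.map_normalClosure _ _ α.symm.surjective, Set.image_pair,
      Subgroup.map_top_of_surjective _ α.symm.surjective] at this
    rw [← this, ← hα]
    simp
  obtain ⟨g, β, hβ, hg⟩ := NielsenProof.std_case (NielsenProof.Primitive_map h₂ α.symm) hn
  refine ⟨1, α g, β.trans α, ?_, ?_⟩
  · simp [hβ, hα]
  · have := congrArg α hg
    simpa using this
end

section
/- Let F₂ be the free group on generators t₁, t₂, and let w₁, w₂ ∈ F₂ satisfy: the reduced word of w₁ is t₁^{k₁} z₁ t₁^{-h₁} with h₁,k₁ ≥ 1 and z₁ nonempty beginning and ending with t₂^{±1}, and w₂ = t₂^{l} for some l ≠ 0. If u is an element of the subgroup J = ⟨w₁, w₂⟩ that is primitive in F₂, then u is conjugate in F₂ to w₁^{±1} or to w₂^{±1}. -/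
namespace Aux

/-- First letter of the reduced word. -/
def s (g : F2) : Option (Fin 2 × Bool) := g.toWord.head?

/-- A letter is the first letter of `x` or of `x⁻¹`. -/
def Ends (x : F2) (c : Fin 2 × Bool) : Prop := s x = some c ∨ s x⁻¹ = some c

lemma s_inv (g : F2) : s g⁻¹ = g.toWord.getLast?.map (fun c => (c.1, !c.2)) := by
  simp [s, FreeGroup.toWord_inv, FreeGroup.invRev]

lemma s_ne_none {g : F2} (h : g ≠ 1) : ∃ c, s g = some c := by
  have h2 : g.toWord ≠ [] := by simpa [FreeGroup.toWord_eq_nil_iff] using h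
  obtain ⟨c, L, hL⟩ := List.exists_cons_of_ne_nil h2
  exact ⟨c, by simp [s, hL]⟩

lemma s_one : s 1 = none := by simp [s]

lemma ne_one_of_s {g : F2} {c} (h : s g = some c) : g ≠ 1 := by
  rintro rfl
  simp [s_one] at h

/-- No cancellation in the product. -/
def NC (a b : F2) : Prop := ∀ c, s a⁻¹ = some c → s b = some c → False

lemma toWord_mul_of_nc {a b : F2} (h : NC a b) : (a * b).toWord = a.toWord ++ b.toWord := by
  rw [FreeGroup.toWord_mul]
  apply FreeGroup.IsReduced.reduce_eq
  unfold FreeGroup.IsReduced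
  rw [List.isChain_append]
  refine ⟨FreeGroup.isReduced_toWord, FreeGroup.isReduced_toWord, ?_⟩
  intro x hx y hy h1
  by_contra h2
  apply h y
  · rw [s_inv, Option.mem_def.mp hx]
    simp only [Option.map_some, Option.some.injEq]
    ext1
    · exact h1
    · revert h2
      cases x.2 <;> cases y.2 <;> simp
  · exact hy

lemma s_mul_of_nc {a b : F2} (h : NC a b) (ha : a ≠ 1) : s (a * b) = s a := by
  obtain ⟨c, hc⟩ := s_ne_none ha
  unfold s at *
  rw [toWord_mul_of_nc h, List.head?_append, hc]
  rfl

lemma s_pow (x : F2) (n : ℕ) : s (x ^ (n + 1)) = s x := by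
  by_cases hx : x = 1
  · simp [hx]
  have h1 : x.toWord = _ :=
    (FreeGroup.reduceCyclically.conj_conjugator_reduceCyclically x.toWord).symm
  have hne : FreeGroup.reduceCyclically x.toWord ≠ [] := by
    intro h0
    rw [h0] at h1
    apply hx
    rw [← FreeGroup.mk_toWord (x := x), h1, List.append_nil, ← FreeGroup.mul_mk,
      ← FreeGroup.inv_mk, mul_inv_cancel]
  unfold s
  rw [FreeGroup.toWord_pow,
    FreeGroup.reduceCyclically.reduce_flatten_replicate_succ FreeGroup.isReduced_toWord]
  nth_rewrite 4 [h1]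
  obtain ⟨c, L, hL⟩ := List.exists_cons_of_ne_nil hne
  rw [hL, List.replicate_succ]
  simp [List.head?_append]

lemma s_zpow_pos (x : F2) {n : ℤ} (hn : 0 < n) : s (x ^ n) = s x := by
  obtain ⟨k, rfl⟩ : ∃ k : ℕ, n = (k + 1 : ℕ) := ⟨n.toNat - 1, by omega⟩
  rw [zpow_natCast]
  exact s_pow x k

lemma ends_zpow (x : F2) {n : ℤ} (hn : n ≠ 0) {c} (h : s (x ^ n) = some c) : Ends x c := by
  rcases lt_or_gt_of_ne hn with h1 | h1
  · right
    have : x ^ n = x⁻¹ ^ (-n) := by simp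
    rw [this, s_zpow_pos _ (by omega)] at h
    exact h
  · left
    rwa [s_zpow_pos _ h1] at h

lemma zpow_ne_one {x : F2} (hx : x ≠ 1) {n : ℤ} (hn : n ≠ 0) : x ^ n ≠ 1 := by
  intro h
  rcases lt_or_gt_of_ne hn with h1 | h1
  · have h2 : s (x⁻¹ ^ (-n)) = s x⁻¹ := s_zpow_pos _ (by omega)
    obtain ⟨c, hc⟩ := s_ne_none (inv_ne_one.mpr hx)
    have : x ^ n = x⁻¹ ^ (-n) := by simp
    rw [← this, h, s_one, hc] at h2
    simp at h2
  · have h2 : s (x ^ n) = s x := s_zpow_pos _ h1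
    obtain ⟨c, hc⟩ := s_ne_none hx
    rw [h, s_one, hc] at h2
    simp at h2

/-- Alternating products of powers of `x` and `y`. -/
def v : F2 → F2 → List ℤ → F2
  | _, _, [] => 1
  | x, y, n :: L => x ^ n * v y x L

/-- `x` and `y` are nontrivial, and there is no cancellation between their powers. -/
structure Disj (x y : F2) : Prop where
  hx : x ≠ 1
  hy : y ≠ 1
  d : ∀ c, Ends x c → Ends y c → False

lemma Disj.symm {x y : F2} (h : Disj x y) : Disj y x := ⟨h.hy, h.hx, fun c a b => h.d c b a⟩

lemma v_cons {x y : F2} (h : Disj x y) (n : ℤ) (L : List ℤ) (hn : n ≠ 0) (hL : ∀ m ∈ L, m ≠ 0) :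
    (v x y (n :: L)).toWord = (x ^ n).toWord ++ (v y x L).toWord ∧
    s (v x y (n :: L)) = s (x ^ n) := by
  induction L generalizing x y n with
  | nil => simp [v]
  | cons m L ih =>
    have hi := (ih h.symm m (hL m (by simp)) (fun k hk => hL k (by simp [hk]))).2
    have nc : NC (x ^ n) (v y x (m :: L)) := by
      intro c h1 h2
      rw [hi] at h2
      rw [← zpow_neg] at h1
      exact h.d c (ends_zpow x (neg_ne_zero.mpr hn) h1) (ends_zpow y (hL m (by simp)) h2)
    constructor
    · rw [v, toWord_mul_of_nc nc]
    · rw [v, s_mul_of_nc nc (zpow_ne_one h.hx hn)]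

lemma v_length {x y : F2} (h : Disj x y) (L : List ℤ) (hL : ∀ m ∈ L, m ≠ 0) :
    L.length ≤ (v x y L).toWord.length := by
  induction L generalizing x y with
  | nil => simp
  | cons n L ih =>
    have hn : n ≠ 0 := hL n (by simp)
    have hL' : ∀ m ∈ L, m ≠ 0 := fun k hk => hL k (by simp [hk])
    rw [(v_cons h n L hn hL').1]
    have h1 : (x ^ n).toWord.length ≠ 0 := by
      simpa [FreeGroup.toWord_eq_nil_iff] using zpow_ne_one h.hx hn
    have := ih h.symm hL'
    simp only [List.length_cons, List.length_append]
    omega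

lemma v_append_even {x y : F2} (L K : List ℤ) (he : Even L.length) :
    v x y (L ++ K) = v x y L * v x y K := by
  match L, he with
  | [], _ => simp [v]
  | [a], he => simp at he
  | a :: b :: L, he =>
    have he' : Even L.length := by
      simpa [Nat.even_add_one] using he
    simp only [List.cons_append, v]
    rw [v_append_even L K he']
    group

lemma v_append_even_toWord {x y : F2} (h : Disj x y) (L K : List ℤ) (he : Even L.length)
    (hL : ∀ m ∈ L, m ≠ 0) (hK : ∀ m ∈ K, m ≠ 0) :
    (v x y (L ++ K)).toWord = (v x y L).toWord ++ (v x y K).toWord := by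
  match L, he, hL with
  | [], _, _ => simp [v]
  | [a], he, _ => simp at he
  | a :: b :: L, he, hL =>
    have he' : Even L.length := by
      simpa [Nat.even_add_one] using he
    have ha : a ≠ 0 := hL a (by simp)
    have hb : b ≠ 0 := hL b (by simp)
    have hL' : ∀ m ∈ L, m ≠ 0 := fun k hk => hL k (by simp [hk])
    have hLK : ∀ m ∈ L ++ K, m ≠ 0 := by
      intro k hk
      rcases List.mem_append.mp hk with h1 | h1
      · exact hL' k h1
      · exact hK k h1
    simp only [List.cons_append]
    rw [(v_cons h a (b :: (L ++ K)) ha (by simpa [hb] using hLK)).1,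
      (v_cons h a (b :: L) ha (by simpa [hb] using hL')).1,
      (v_cons h.symm b (L ++ K) hb hLK).1, (v_cons h.symm b L hb hL').1,
      v_append_even_toWord h L K he' hL' hK]
    simp

lemma v_snoc_odd {x y : F2} (M : List ℤ) (m : ℤ) (he : Even M.length) :
    v x y (M ++ [m]) = v x y M * x ^ m := by
  rw [v_append_even M [m] he]
  simp [v]

/-- Representability as an alternating product. -/
def Rep (x y g : F2) : Prop := ∃ L : List ℤ, (∀ m ∈ L, m ≠ 0) ∧ (g = v x y L ∨ g = v y x L)

lemma Rep.symm {x y g : F2} (h : Rep x y g) : Rep y x g := by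
  obtain ⟨L, h1, h2⟩ := h
  exact ⟨L, h1, h2.symm⟩

lemma Rep.zpow_mul {x y g : F2} (h : Rep x y g) (n : ℤ) (hn : n ≠ 0) : Rep x y (x ^ n * g) := by
  obtain ⟨L, h1, h2⟩ := h
  have key : Rep x y (x ^ n * v y x L) :=
    ⟨n :: L, by simpa [hn] using h1, Or.inl rfl⟩
  rcases h2 with rfl | rfl
  · match L, h1 with
    | [], _ => simpa [v] using key
    | m :: L, h1 =>
      simp only [v]
      have hL : ∀ m ∈ L, m ≠ 0 := fun k hk => h1 k (by simp [hk])
      rw [← mul_assoc, ← zpow_add]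
      by_cases h0 : n + m = 0
      · rw [h0]
        exact ⟨L, hL, Or.inr (by simp)⟩
      · exact ⟨(n + m) :: L, by simpa [h0] using hL, Or.inl rfl⟩
  · exact key

lemma rep_of_mem {x y g : F2} (h : g ∈ Subgroup.closure ({x, y} : Set F2)) : Rep x y g := by
  induction h using Subgroup.closure_induction_left with
  | one => exact ⟨[], by simp, by simp [v]⟩
  | mul_left a ha b hb ih =>
    rcases ha with rfl | ha
    · simpa using ih.zpow_mul 1 (by norm_num)
    · rw [Set.mem_singleton_iff] at ha
      subst ha
      simpa using (ih.symm.zpow_mul 1 (by norm_num)).symm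
  | inv_mul_cancel a ha b hb ih =>
    rcases ha with rfl | ha
    · simpa using ih.zpow_mul (-1) (by norm_num)
    · rw [Set.mem_singleton_iff] at ha
      subst ha
      simpa using (ih.symm.zpow_mul (-1) (by norm_num)).symm

/-- Up to conjugation the alternating product may be taken to be short or of even length. -/
lemma conj_normal (N : ℕ) : ∀ (x y : F2) (L : List ℤ), L.length ≤ N → (∀ m ∈ L, m ≠ 0) →
    ∃ (g : F2) (K : List ℤ), (∀ m ∈ K, m ≠ 0) ∧ (K.length ≤ 1 ∨ Even K.length) ∧
      (v x y L = g * v x y K * g⁻¹ ∨ v x y L = g * v y x K * g⁻¹) := by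
  induction N with
  | zero =>
    intro x y L h1 h2
    exact ⟨1, L, h2, Or.inl (by omega), by simp⟩
  | succ N ih =>
    intro x y L h1 h2
    by_cases hs : L.length ≤ 1 ∨ Even L.length
    · exact ⟨1, L, h2, hs, by simp⟩
    · push Not at hs
      obtain ⟨hs1, hs2⟩ := hs
      rcases L with _ | ⟨n, L⟩
      · simp at hs1
      rcases List.eq_nil_or_concat L with rfl | ⟨M, m, rfl⟩
      · simp at hs1
      have he : Even (n :: M).length := by
        simpa [Nat.even_add_one] using hs2
      have hM : ∀ m ∈ M, m ≠ 0 := fun k hk => h2 k (by simp [hk])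
      have e1 : v x y (n :: (M ++ [m])) = x ^ (-m) * (x ^ (m + n) * v y x M) * (x ^ (-m))⁻¹ := by
        rw [← List.cons_append, v_snoc_odd _ _ he, v]
        group
      by_cases h0 : m + n = 0
      · simp only [List.length_cons, List.length_concat] at h1
        obtain ⟨g, K, hK, hK2, hK3⟩ := ih y x M (by omega) hM
        refine ⟨x ^ (-m) * g, K, hK, hK2, ?_⟩
        rw [List.concat_eq_append, e1, h0, zpow_zero, one_mul]
        rcases hK3 with hK3 | hK3
        · right
          rw [hK3]
          group
        · left
          rw [hK3]
          group
      · refine ⟨x ^ (-m), (m + n) :: M, by simpa [h0] using hM, Or.inr (by simpa using he), ?_⟩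
        left
        rw [List.concat_eq_append, e1, v]

/-- Edge paths in a theta graph with arcs `e`. -/
def tv : (Fin 3 → F2) → List (Fin 3) → F2
  | _, [] => 1
  | e, i :: L => e i * tv e⁻¹ L

/-- The theta graph with arcs `e` is immersed. -/
structure Imm (e : Fin 3 → F2) : Prop where
  ne : ∀ i, e i ≠ 1
  i1 : ∀ i j, s (e i) = s (e j) → i = j
  i2 : ∀ i j, s (e i)⁻¹ = s (e j)⁻¹ → i = j

lemma Imm.inv {e : Fin 3 → F2} (h : Imm e) : Imm e⁻¹ :=
  ⟨fun i => by simpa using h.ne i, fun i j => by simpa using h.i2 i j,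
    fun i j => by simpa using h.i1 i j⟩

lemma tv_cons {e : Fin 3 → F2} (h : Imm e) (i : Fin 3) (L : List (Fin 3))
    (hL : (i :: L).IsChain (· ≠ ·)) :
    (tv e (i :: L)).toWord = (e i).toWord ++ (tv e⁻¹ L).toWord ∧ s (tv e (i :: L)) = s (e i) := by
  induction L generalizing e i with
  | nil => simp [tv]
  | cons j L ih =>
    rw [List.isChain_cons_cons] at hL
    have hi := (ih h.inv j hL.2).2
    have nc : NC (e i) (tv e⁻¹ (j :: L)) := by
      intro c h1 h2
      rw [hi] at h2
      exact hL.1 (h.i2 i j (by rw [h1, ← h2]; rfl))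
    constructor
    · rw [tv, toWord_mul_of_nc nc]
    · rw [tv, s_mul_of_nc nc (h.ne i)]

lemma tv_length {e : Fin 3 → F2} (h : Imm e) (L : List (Fin 3))
    (hL : L.IsChain (· ≠ ·)) : L.length ≤ (tv e L).toWord.length := by
  induction L generalizing e with
  | nil => simp
  | cons n L ih =>
    rw [(tv_cons h n L hL).1]
    have h1 : (e n).toWord.length ≠ 0 := by
      simpa [FreeGroup.toWord_eq_nil_iff] using h.ne n
    have := ih h.inv hL.tail
    simp only [List.length_cons, List.length_append]
    omega

lemma tv_push (e : Fin 3 → F2) (i : Fin 3) (L : List (Fin 3)) (hL : L.IsChain (· ≠ ·)) :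
    ∃ K : List (Fin 3), K.IsChain (· ≠ ·) ∧ (Even K.length ↔ ¬ Even L.length) ∧
      e i * tv e⁻¹ L = tv e K := by
  rcases L with _ | ⟨j, L⟩
  · exact ⟨[i], by simp, by simp, by simp [tv]⟩
  · by_cases hij : i = j
    · subst hij
      refine ⟨L, hL.tail, ?_, by simp [tv]⟩
      simp [Nat.even_add_one]
    · refine ⟨i :: j :: L, ?_, ?_, by simp [tv]⟩
      · rw [List.isChain_cons_cons]
        exact ⟨hij, hL⟩
      · simp [Nat.even_add_one]

lemma tv_push2 (e : Fin 3 → F2) (i j : Fin 3) (L : List (Fin 3)) (hL : L.IsChain (· ≠ ·))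
    (he : Even L.length) :
    ∃ K : List (Fin 3), K.IsChain (· ≠ ·) ∧ Even K.length ∧
      e i * (e j)⁻¹ * tv e L = tv e K := by
  obtain ⟨K, h1, h2, h3⟩ := tv_push e⁻¹ j L hL
  obtain ⟨K', h1', h2', h3'⟩ := tv_push e i K h1
  refine ⟨K', h1', ?_, ?_⟩
  · rw [h2', h2]
    simpa using he
  · rw [← h3', ← h3]
    simp [mul_assoc]

lemma imm_not_top {e : Fin 3 → F2} (h : Imm e) :
    Subgroup.closure ({e 0 * (e 1)⁻¹, e 0 * (e 2)⁻¹} : Set F2) ≠ ⊤ := by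
  intro htop
  have key : ∀ g ∈ Subgroup.closure ({e 0 * (e 1)⁻¹, e 0 * (e 2)⁻¹} : Set F2),
      ∃ K : List (Fin 3), K.IsChain (· ≠ ·) ∧ Even K.length ∧ g = tv e K := by
    intro g hg
    induction hg using Subgroup.closure_induction_left with
    | one => exact ⟨[], by simp, by simp, by simp [tv]⟩
    | mul_left a ha b hb ih =>
      obtain ⟨K, h1, h2, rfl⟩ := ih
      rcases ha with rfl | rfl
      · exact tv_push2 e 0 1 K h1 h2
      · exact tv_push2 e 0 2 K h1 h2
    | inv_mul_cancel a ha b hb ih =>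
      obtain ⟨K, h1, h2, rfl⟩ := ih
      rcases ha with rfl | rfl
      · simpa using tv_push2 e 1 0 K h1 h2
      · simpa using tv_push2 e 2 0 K h1 h2
  obtain ⟨K, h1, h2, h3⟩ := key t1 (by rw [htop]; trivial)
  have h4 := tv_length h K h1
  rw [← h3] at h4
  simp only [t1, FreeGroup.toWord_of, List.length_singleton] at h4
  rcases K with _ | ⟨a, _ | ⟨b, K⟩⟩
  · exact FreeGroup.of_ne_one _ h3
  · simp at h2
  · simp at h4

/-- Generating pairs. -/
def Gen (x y : F2) : Prop := Subgroup.closure ({x, y} : Set F2) = ⊤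

/-- Invariance of a predicate on pairs under Nielsen moves and conjugation. -/
structure NInv (P : F2 → F2 → Prop) : Prop where
  swap : ∀ x y, P x y → P y x
  inv : ∀ x y, P x y → P x⁻¹ y
  mul : ∀ x y, P x y → P (x * y) y
  conj : ∀ x y g, P x y → P (g * x * g⁻¹) (g * y * g⁻¹)

lemma gen_of {x y x' y' : F2} (h : Gen x y) (hx : x ∈ Subgroup.closure ({x', y'} : Set F2))
    (hy : y ∈ Subgroup.closure ({x', y'} : Set F2)) : Gen x' y' := by
  unfold Gen at *
  rw [eq_top_iff, ← h, Subgroup.closure_le]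
  rintro a (rfl | rfl)
  · exact hx
  · exact hy

lemma mem1 (x y : F2) : x ∈ Subgroup.closure ({x, y} : Set F2) :=
  Subgroup.subset_closure (by simp)

lemma mem2 (x y : F2) : y ∈ Subgroup.closure ({x, y} : Set F2) :=
  Subgroup.subset_closure (by simp)

lemma gen_ninv : NInv Gen where
  swap x y h := gen_of h (mem2 _ _) (mem1 _ _)
  inv x y h := gen_of h (by simpa using inv_mem (mem1 x⁻¹ y)) (mem2 _ _)
  mul x y h := gen_of h (by simpa using mul_mem (mem1 (x * y) y) (inv_mem (mem2 (x * y) y)))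
    (mem2 _ _)
  conj x y g h := by
    unfold Gen at *
    have h1 := MonoidHom.map_closure (MulAut.conj g).toMonoidHom ({x, y} : Set F2)
    rw [h, Set.image_pair] at h1
    simp only [MulEquiv.toMonoidHom_eq_coe, MonoidHom.coe_coe, MulAut.conj_apply] at h1
    rw [← h1]
    exact Subgroup.map_top_of_surjective _ (MulAut.conj g).surjective

lemma NInv.inv2 {P} (h : NInv P) {x y : F2} (hP : P x y) : P x y⁻¹ :=
  h.swap _ _ (h.inv _ _ (h.swap _ _ hP))

lemma NInv.mul' {P} (h : NInv P) {x y : F2} (hP : P x y) : P (x * y⁻¹) y := by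
  simpa using h.inv2 (h.mul _ _ (h.inv2 hP))

/-- The induced predicate on theta graphs. -/
def Th (P : F2 → F2 → Prop) (p q r : F2) : Prop := P (p * q⁻¹) (p * r⁻¹)

lemma Th.swap23 {P} (h : NInv P) {p q r : F2} (hT : Th P p q r) : Th P p r q := h.swap _ _ hT

lemma Th.swap12 {P} (h : NInv P) {p q r : F2} (hT : Th P p q r) : Th P q p r := by
  have h1 := h.swap _ _ (h.mul' (h.swap _ _ hT))
  have h2 := h.inv _ _ h1
  have h3 := h.conj _ _ (p * q⁻¹)⁻¹ h2
  unfold Th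
  convert h3 using 1 <;> group

lemma Th.shift {P} (h : NInv P) {p q r : F2} (c : F2) (hT : Th P p q r) :
    Th P (c * p) (c * q) (c * r) := by
  have h3 := h.conj _ _ c hT
  unfold Th
  convert h3 using 1 <;> group

lemma Th.invs {P} (h : NInv P) {p q r : F2} (hT : Th P p q r) : Th P p⁻¹ q⁻¹ r⁻¹ := by
  have h3 := h.inv2 (h.inv _ _ (h.conj _ _ p⁻¹ hT))
  unfold Th
  convert h3 using 1 <;> group

lemma norm_letter_inv (x : F2) (c : Fin 2 × Bool) (h : s x = some c) :
    ((FreeGroup.mk [c])⁻¹ * x).norm + 1 ≤ x.norm := by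
  obtain ⟨L, hL⟩ : ∃ L, x.toWord = c :: L := by
    unfold s at h
    cases hx : x.toWord with
    | nil => simp [hx] at h
    | cons a L => exact ⟨L, by simp [hx] at h; rw [h]⟩
  have h1 : x = FreeGroup.mk [c] * FreeGroup.mk L := by
    rw [FreeGroup.mul_mk, ← FreeGroup.mk_toWord (x := x), hL]
    rfl
  have h2 : x.norm = L.length + 1 := by simp [FreeGroup.norm, hL]
  rw [h2, h1, inv_mul_cancel_left]
  have := FreeGroup.norm_mk_le (L₁ := L)
  omega

lemma norm_letter_mul (x : F2) (c : Fin 2 × Bool) :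
    ((FreeGroup.mk [c])⁻¹ * x).norm ≤ x.norm + 1 := by
  have h1 := FreeGroup.norm_mul_le (FreeGroup.mk [c])⁻¹ x
  have h2 : (FreeGroup.mk [c])⁻¹.norm ≤ 1 := by
    rw [FreeGroup.norm_inv_eq]
    exact FreeGroup.norm_mk_le
  omega

lemma not_comm (q : F2) (i j : ℤ) (h1 : t1 = q ^ i) (h2 : t2 = q ^ j) : False := by
  have h3 : t1 * t2 = t2 * t1 := by
    rw [h1, h2, ← zpow_add, ← zpow_add, add_comm]
  have : (t1 * t2).toWord = (t2 * t1).toWord := by rw [h3]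
  revert this
  decide

/-- Exponent sum of a letter. -/
def ex (k : Fin 2) : F2 →* Multiplicative ℤ :=
  FreeGroup.lift (fun i => if i = k then Multiplicative.ofAdd 1 else 1)

lemma gen_zpow (k : Fin 2) (q : F2) (i : ℤ) (h : FreeGroup.of k = q ^ i) :
    q = FreeGroup.of k ∨ q = (FreeGroup.of k)⁻¹ := by
  have h1 : (1 : ℤ) = i * (ex k q).toAdd := by
    have := congrArg (fun g => (ex k g).toAdd) h
    simpa [ex] using this
  rcases Int.isUnit_iff.mp (IsUnit.of_mul_eq_one _ h1.symm) with rfl | rfl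
  · left
    simpa using h.symm
  · right
    rw [h]
    simp

lemma gen_not_cyclic (r : F2) (h : Gen 1 r) : False := by
  have key : ∀ g : F2, ∃ i : ℤ, g = r ^ i := by
    intro g
    have hg : g ∈ Subgroup.closure ({1, r} : Set F2) := by
      rw [h]
      trivial
    rw [Subgroup.closure_insert_one, Subgroup.mem_closure_singleton] at hg
    obtain ⟨n, hn⟩ := hg
    exact ⟨n, hn.symm⟩
  obtain ⟨i, hi⟩ := key t1
  obtain ⟨j, hj⟩ := key t2
  exact not_comm r i j hi hj

lemma rep_norm_one {q r : F2} (hd : Disj q r) (k : Fin 2) (h : Gen q r) :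
    ∃ i : ℤ, FreeGroup.of k = q ^ i ∨ FreeGroup.of k = r ^ i := by
  obtain ⟨L, hL, h1⟩ := rep_of_mem (g := FreeGroup.of k) (x := q) (y := r) (by rw [h]; trivial)
  have hlen : L.length ≤ 1 := by
    rcases h1 with h1 | h1
    · have := v_length hd L hL
      rwa [← h1, FreeGroup.toWord_of] at this
    · have := v_length hd.symm L hL
      rwa [← h1, FreeGroup.toWord_of] at this
  rcases L with _ | ⟨a, _ | ⟨b, L⟩⟩
  · simp [v, FreeGroup.of_ne_one] at h1
  · simp only [v, mul_one] at h1
    exact ⟨a, h1⟩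
  · simp at hlen

lemma rose_base {P : F2 → F2 → Prop} (hP : NInv P) (h0 : P t1 t2) {q r : F2} (hd : Disj q r)
    (h : Gen q r) : P q r := by
  have hs : ∀ x y, (x = t1 ∨ x = t1⁻¹) → (y = t2 ∨ y = t2⁻¹) → P x y := by
    rintro x y (rfl | rfl) (rfl | rfl)
    · exact h0
    · exact hP.inv2 h0
    · exact hP.inv _ _ h0
    · exact hP.inv2 (hP.inv _ _ h0)
  obtain ⟨i, hi⟩ := rep_norm_one hd 0 h
  obtain ⟨j, hj⟩ := rep_norm_one hd 1 h
  rcases hi with hi | hi <;> rcases hj with hj | hj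
  · exact (not_comm q i j hi hj).elim
  · exact hs _ _ (gen_zpow _ _ _ hi) (gen_zpow _ _ _ hj)
  · exact hP.swap _ _ (hs _ _ (gen_zpow _ _ _ hi) (gen_zpow _ _ _ hj))
  · exact (not_comm r i j hi hj).elim

lemma imp_ninv {P : F2 → F2 → Prop} (hP : NInv P) : NInv (fun x y => Gen x y → P x y) where
  swap x y h g := hP.swap _ _ (h (gen_ninv.swap _ _ g))
  inv x y h g := hP.inv _ _ (h (by simpa using gen_ninv.inv _ _ g))
  mul x y h g := hP.mul _ _ (h (by simpa using gen_ninv.mul' g))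
  conj x y c h g := hP.conj _ _ c (h (by
    have := gen_ninv.conj _ _ c⁻¹ g
    convert this using 1 <;> group))

/-- The main induction: theta graphs can be shortened until they are a standard rose. -/
theorem theta_all {P : F2 → F2 → Prop} (hP : NInv P) (h0 : P t1 t2) (N : ℕ) :
    ∀ p q r : F2, p.norm + q.norm + r.norm ≤ N →
      Th (fun x y => Gen x y → P x y) p q r := by
  have hR := imp_ninv hP
  set R : F2 → F2 → Prop := fun x y => Gen x y → P x y with hRdef
  induction N using Nat.strong_induction_on with
  | _ N ih =>
  -- two arcs with the same first letter
  have fold : ∀ p q r : F2, p.norm + q.norm + r.norm ≤ N → p ≠ 1 → s p = s q → Th R p q r := by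
    intro p q r hN hp hs
    obtain ⟨c, hc⟩ := s_ne_none hp
    have h1 := norm_letter_inv p c hc
    have h2 := norm_letter_inv q c (hs ▸ hc)
    have h3 := norm_letter_mul r c
    have h4 := ih (N - 1) (by omega) _ _ _ (show ((FreeGroup.mk [c])⁻¹ * p).norm +
      ((FreeGroup.mk [c])⁻¹ * q).norm + ((FreeGroup.mk [c])⁻¹ * r).norm ≤ N - 1 by omega)
    simpa only [mul_inv_cancel_left] using h4.shift hR (FreeGroup.mk [c])
  have fold' : ∀ p q r : F2, p.norm + q.norm + r.norm ≤ N → p ≠ 1 → s p⁻¹ = s q⁻¹ →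
      Th R p q r := by
    intro p q r hN hp hs
    have := fold p⁻¹ q⁻¹ r⁻¹ (by simpa only [FreeGroup.norm_inv_eq] using hN)
      (inv_ne_one.mpr hp) hs
    simpa using this.invs hR
  -- one arc is trivial
  have rose : ∀ q r : F2, q.norm + r.norm ≤ N → Th R 1 q r := by
    intro q r hN
    by_cases hq : q = 1
    · intro hg
      subst hq
      simp only [inv_one, mul_one] at hg
      exact (gen_not_cyclic _ hg).elim
    by_cases hr : r = 1
    · intro hg
      subst hr
      simp only [inv_one, mul_one] at hg
      exact (gen_not_cyclic _ (gen_ninv.swap _ _ hg)).elim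
    have f1 : ∀ a b : F2, a.norm + b.norm ≤ N → a ≠ 1 → s a = s b → R a⁻¹ b⁻¹ := by
      intro a b hab ha hs
      have := fold a b 1 (by simpa using hab) ha hs
      have h2 := (this.swap23 hR).swap12 hR
      simpa [Th] using h2
    have hri : r⁻¹ ≠ 1 := inv_ne_one.mpr hr
    have hqi : q⁻¹ ≠ 1 := inv_ne_one.mpr hq
    by_cases hd : Disj q r
    · intro hg
      simp only [one_mul] at hg ⊢
      have hg' : Gen q r := by simpa using gen_ninv.inv2 (gen_ninv.inv _ _ hg)
      exact hP.inv2 (hP.inv _ _ (rose_base hP h0 hd hg'))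
    · have : ∃ c, Ends q c ∧ Ends r c := by
        by_contra hcon
        push Not at hcon
        exact hd ⟨hq, hr, hcon⟩
      obtain ⟨c, h1 | h1, h2 | h2⟩ := this
      · have := f1 q r hN hq (h1.trans h2.symm)
        simpa [Th] using this
      · have := f1 q r⁻¹ (by simpa only [FreeGroup.norm_inv_eq] using hN) hq (h1.trans h2.symm)
        simpa [Th] using hR.inv2 this
      · have := f1 q⁻¹ r (by simpa only [FreeGroup.norm_inv_eq] using hN) hqi (h1.trans h2.symm)
        simpa [Th] using hR.inv _ _ this
      · have := f1 q⁻¹ r⁻¹ (by simpa only [FreeGroup.norm_inv_eq] using hN) hqi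
          (h1.trans h2.symm)
        simpa [Th] using hR.inv2 (hR.inv _ _ this)
  intro p q r hN
  by_cases hp : p = 1
  · subst hp
    exact rose q r (by simpa using hN)
  by_cases hq : q = 1
  · subst hq
    exact (rose p r (by simpa using hN)).swap12 hR
  by_cases hr : r = 1
  · subst hr
    exact ((rose p q (by simpa using hN)).swap12 hR).swap23 hR
  by_cases a1 : s p = s q
  · exact fold _ _ _ hN hp a1
  by_cases a2 : s p = s r
  · exact (fold p r q (by omega) hp a2).swap23 hR
  by_cases a3 : s q = s r
  · exact ((fold q r p (by omega) hq a3).swap23 hR).swap12 hR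
  by_cases b1 : s p⁻¹ = s q⁻¹
  · exact fold' _ _ _ hN hp b1
  by_cases b2 : s p⁻¹ = s r⁻¹
  · exact (fold' p r q (by omega) hp b2).swap23 hR
  by_cases b3 : s q⁻¹ = s r⁻¹
  · exact ((fold' q r p (by omega) hq b3).swap23 hR).swap12 hR
  intro hg
  exfalso
  refine imm_not_top (e := ![p, q, r]) ⟨?_, ?_, ?_⟩ hg
  · intro i
    fin_cases i
    · exact hp
    · exact hq
    · exact hr
  · intro i j hij
    fin_cases i <;> fin_cases j <;> simp_all [eq_comm]
  · intro i j hij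
    fin_cases i <;> fin_cases j <;> simp_all [eq_comm]

theorem nielsen {P : F2 → F2 → Prop} (hP : NInv P) (h0 : P t1 t2) {x y : F2} (h : Gen x y) :
    P x y := by
  have := theta_all hP h0 _ 1 x⁻¹ y⁻¹ le_rfl
  simp only [Th, one_mul, inv_inv] at this
  exact this h

/-- Positive bases, up to conjugation. -/
inductive B : F2 → F2 → Prop
  | base (X Y : F2) (hX : X = t1 ∨ X = t1⁻¹) (hY : Y = t2 ∨ Y = t2⁻¹) : B X Y
  | base' (X Y : F2) (hX : X = t1 ∨ X = t1⁻¹) (hY : Y = t2 ∨ Y = t2⁻¹) : B Y X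
  | left (X Y : F2) (h : B X Y) : B (X * Y) Y
  | right (X Y : F2) (h : B X Y) : B X (Y * X)

lemma B.symm {X Y : F2} (h : B X Y) : B Y X := by
  induction h with
  | base X Y hX hY => exact B.base' X Y hX hY
  | base' X Y hX hY => exact B.base X Y hX hY
  | left X Y h ih => exact B.right _ _ ih
  | right X Y h ih => exact B.left _ _ ih

/-- Pairs which are positive bases up to inversions and simultaneous conjugation. -/
def S (x y : F2) : Prop := ∃ X Y g : F2, B X Y ∧ (x = g * X * g⁻¹ ∨ x = g * X⁻¹ * g⁻¹) ∧
  (y = g * Y * g⁻¹ ∨ y = g * Y⁻¹ * g⁻¹)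

lemma S.swap {x y : F2} (h : S x y) : S y x := by
  obtain ⟨X, Y, g, h1, h2, h3⟩ := h
  exact ⟨Y, X, g, h1.symm, h3, h2⟩

lemma S.inv {x y : F2} (h : S x y) : S x⁻¹ y := by
  obtain ⟨X, Y, g, h1, h2, h3⟩ := h
  refine ⟨X, Y, g, h1, ?_, h3⟩
  rcases h2 with rfl | rfl
  · right
    group
  · left
    group

lemma S.inv2 {x y : F2} (h : S x y) : S x y⁻¹ := h.swap.inv.swap

lemma S.conj {x y : F2} (g : F2) (h : S x y) : S (g * x * g⁻¹) (g * y * g⁻¹) := by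
  obtain ⟨X, Y, k, h1, h2, h3⟩ := h
  refine ⟨X, Y, g * k, h1, ?_, ?_⟩
  · rcases h2 with rfl | rfl
    · left
      group
    · right
      group
  · rcases h3 with rfl | rfl
    · left
      group
    · right
      group

lemma B.toS {X Y : F2} (h : B X Y) : S X Y := ⟨X, Y, 1, h, by simp, by simp⟩

lemma inv_flip {X t : F2} (h : X = t ∨ X = t⁻¹) : X⁻¹ = t ∨ X⁻¹ = t⁻¹ := by
  rcases h with rfl | rfl
  · exact Or.inr rfl
  · exact Or.inl (inv_inv _)

lemma B.div {X Y : F2} (h : B X Y) : S (X * Y⁻¹) Y := by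
  cases h with
  | base X Y hX hY =>
    simpa using (B.left _ _ (B.base X Y⁻¹ hX (inv_flip hY))).toS.inv2
  | base' X Y hX hY =>
    simpa using (B.left _ _ (B.base' Y⁻¹ X (inv_flip hX) hY)).toS.inv2
  | left X Y h => simpa using h.toS
  | right X Y h =>
    have h1 := ((B.left _ _ h).toS.swap.inv).conj Y
    convert h1 using 1 <;> group

lemma S.mul {x y : F2} (h : S x y) : S (x * y) y := by
  obtain ⟨X, Y, g, h1, rfl | rfl, rfl | rfl⟩ := h
  · convert (B.left _ _ h1).toS.conj g using 1
    group
  · convert h1.div.inv2.conj g using 1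
    group
  · convert (h1.div.conj Y⁻¹).inv.conj g using 1 <;> group
  · convert ((B.left _ _ h1).toS.conj Y).inv.inv2.conj g using 1 <;> group

lemma S_ninv : NInv S where
  swap _ _ h := h.swap
  inv _ _ h := h.inv
  mul _ _ h := h.mul
  conj _ _ g h := h.conj g

lemma gen_S {x y : F2} (h : Gen x y) : S x y :=
  nielsen S_ninv (B.base t1 t2 (Or.inl rfl) (Or.inl rfl)).toS h

/-- Elements whose reduced word avoids a letter. -/
def Av (c : Fin 2 × Bool) : Submonoid F2 where
  carrier := {g | c ∉ g.toWord}
  one_mem' := by simp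
  mul_mem' := by
    intro a b ha hb h
    have := (FreeGroup.toWord_mul_sublist a b).subset h
    rcases List.mem_append.mp this with h1 | h1
    · exact ha h1
    · exact hb h1

lemma av_inv {e : Bool} {g : F2} (h : g ∈ Av (0, e)) : g⁻¹ ∈ Av (0, !e) := by
  intro h1
  apply h
  rw [FreeGroup.toWord_inv, FreeGroup.invRev] at h1
  simpa using h1

lemma base_av {X Y : F2} (hX : X = t1 ∨ X = t1⁻¹) (hY : Y = t2 ∨ Y = t2⁻¹) :
    ∃ e, X ∈ Av (0, e) ∧ Y ∈ Av (0, e) := by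
  have h2 : ∀ e, Y ∈ Av (0, e) := by
    intro e
    change _ ∉ _
    rcases hY with rfl | rfl
    · simp [t2]
    · simp [t2, FreeGroup.toWord_inv, FreeGroup.invRev]
  rcases hX with rfl | rfl
  · refine ⟨false, ?_, h2 _⟩
    change _ ∉ _
    simp [t1]
  · refine ⟨true, ?_, h2 _⟩
    change _ ∉ _
    simp [t1, FreeGroup.toWord_inv, FreeGroup.invRev]

lemma B.av {X Y : F2} (h : B X Y) : ∃ e, X ∈ Av (0, e) ∧ Y ∈ Av (0, e) := by
  induction h with
  | base X Y hX hY => exact base_av hX hY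
  | base' X Y hX hY =>
    obtain ⟨e, h1, h2⟩ := base_av hX hY
    exact ⟨e, h2, h1⟩
  | left X Y h ih =>
    obtain ⟨e, h1, h2⟩ := ih
    exact ⟨e, mul_mem h1 h2, h2⟩
  | right X Y h ih =>
    obtain ⟨e, h1, h2⟩ := ih
    exact ⟨e, h1, mul_mem h2 h1⟩

/-- Nielsen's criterion: a primitive element is conjugate to a word which avoids one of
`t₁`, `t₁⁻¹`. -/
lemma prim_av {u : F2} (h : Primitive u) : ∃ e g X, X ∈ Av (0, e) ∧ u = g * X * g⁻¹ := by
  obtain ⟨z, hz⟩ := h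
  obtain ⟨X, Y, g, h1, h2, h3⟩ := gen_S hz
  obtain ⟨e, he, -⟩ := h1.av
  rcases h2 with h2 | h2
  · exact ⟨e, g, X, he, h2⟩
  · exact ⟨!e, g, X⁻¹, av_inv he, h2⟩

/-- Integer-valued exponent sum. -/
def ez (k : Fin 2) (g : F2) : ℤ := (ex k g).toAdd

lemma ez_mul (k : Fin 2) (a b : F2) : ez k (a * b) = ez k a + ez k b := by simp [ez]

lemma ez_inv (k : Fin 2) (a : F2) : ez k a⁻¹ = - ez k a := by simp [ez]

lemma ez_zpow (k : Fin 2) (a : F2) (n : ℤ) : ez k (a ^ n) = n * ez k a := by simp [ez]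

/-- Determinant of the abelianized pair. -/
def dt (x y : F2) : ℤ := ez 0 x * ez 1 y - ez 1 x * ez 0 y

lemma unit_ninv : NInv (fun x y => IsUnit (dt x y)) where
  swap x y h := by
    have : dt y x = - dt x y := by unfold dt; ring
    rw [this]
    exact h.neg
  inv x y h := by
    have : dt x⁻¹ y = - dt x y := by unfold dt; simp only [ez_inv]; ring
    rw [this]
    exact h.neg
  mul x y h := by
    have : dt (x * y) y = dt x y := by unfold dt; simp only [ez_mul]; ring
    rw [this]
    exact h
  conj x y g h := by
    have : dt (g * x * g⁻¹) (g * y * g⁻¹) = dt x y := by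
      unfold dt
      simp only [ez_mul, ez_inv]
      ring
    rw [this]
    exact h

lemma prim_zpow {g w : F2} {n : ℤ} (h : Primitive (g * w ^ n * g⁻¹)) : n = 1 ∨ n = -1 := by
  obtain ⟨z, hz⟩ := h
  have h1 : IsUnit (dt (g * w ^ n * g⁻¹) z) := by
    refine nielsen unit_ninv ?_ hz
    have : dt t1 t2 = 1 := by simp [dt, ez, ex, t1, t2]
    rw [this]
    exact isUnit_one
  have h2 : dt (g * w ^ n * g⁻¹) z = n * dt w z := by
    unfold dt
    simp only [ez_mul, ez_inv, ez_zpow]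
    ring
  rw [h2] at h1
  exact Int.isUnit_iff.mp (isUnit_of_mul_isUnit_left h1)

/-- An even alternating product containing both letters `t₁^{±1}` is not primitive. -/
lemma even_not_prim {x y : F2} (hd : Disj x y) (L : List ℤ) (hL : ∀ m ∈ L, m ≠ 0)
    (he : Even L.length) (hc : ∀ e, ((0 : Fin 2), e) ∈ (v x y L).toWord) {e : Bool} {g X : F2}
    (hX : X ∈ Av (0, e)) (h : v x y L = g * X * g⁻¹) : False := by
  have key : ∀ k : ℕ, ∃ K : List ℤ, (∀ m ∈ K, m ≠ 0) ∧ v x y K = (v x y L) ^ k ∧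
      k ≤ (v x y K).toWord.count (0, e) := by
    intro k
    induction k with
    | zero => exact ⟨[], by simp, by simp [v], by simp⟩
    | succ k ih =>
      obtain ⟨K, h1, h2, h3⟩ := ih
      refine ⟨L ++ K, ?_, ?_, ?_⟩
      · intro m hm
        rcases List.mem_append.mp hm with h4 | h4
        · exact hL m h4
        · exact h1 m h4
      · rw [v_append_even _ _ he, h2, pow_succ']
      · rw [v_append_even_toWord hd _ _ he hL h1, List.count_append]
        have := List.count_pos_iff.mpr (hc e)
        omega
  obtain ⟨K, -, h2, h3⟩ := key (g.norm + g⁻¹.norm + 1)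
  rw [h2, h, conj_pow] at h3
  have hsub : ∀ a b : F2, (a * b).toWord.count (0, e) ≤
      a.toWord.count (0, e) + b.toWord.count (0, e) := by
    intro a b
    rw [← List.count_append]
    exact (FreeGroup.toWord_mul_sublist a b).count_le _
  have h4 := hsub (g * X ^ (g.norm + g⁻¹.norm + 1)) g⁻¹
  have h5 := hsub g (X ^ (g.norm + g⁻¹.norm + 1))
  have h6 : (X ^ (g.norm + g⁻¹.norm + 1)).toWord.count (0, e) = 0 :=
    List.count_eq_zero.mpr (pow_mem hX _)
  have h7 : g.toWord.count (0, e) ≤ g.norm := List.count_le_length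
  have h8 : g⁻¹.toWord.count (0, e) ≤ g⁻¹.norm := List.count_le_length
  omega

/-- If both ends of `w` are `t₁`, then nonzero powers of `w` contain both `t₁` and `t₁⁻¹`. -/
lemma both_mem {w : F2} (hw1 : w ≠ 1) (hw : ∀ c, Ends w c → c = (0, true)) {n : ℤ} (hn : n ≠ 0)
    (e : Bool) : ((0 : Fin 2), e) ∈ (w ^ n).toWord := by
  have key : ∀ m : ℤ, m ≠ 0 → ((0 : Fin 2), true) ∈ (w ^ m).toWord := by
    intro m hm
    obtain ⟨c, hc⟩ := s_ne_none (zpow_ne_one hw1 hm)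
    have := hw c (ends_zpow w hm hc)
    subst this
    exact List.mem_of_head? hc
  cases e
  · have h1 := key (-n) (neg_ne_zero.mpr hn)
    rw [zpow_neg, FreeGroup.toWord_inv, FreeGroup.invRev] at h1
    simpa using h1
  · exact key n hn

lemma even_both {w y : F2} (hd : Disj w y) (hw : ∀ c, Ends w c → c = (0, true))
    (L : List ℤ) (hL : ∀ m ∈ L, m ≠ 0) (h2 : 2 ≤ L.length) (e : Bool) :
    ((0 : Fin 2), e) ∈ (v w y L).toWord ∧ ((0 : Fin 2), e) ∈ (v y w L).toWord := by
  rcases L with _ | ⟨a, _ | ⟨b, L⟩⟩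
  · simp at h2
  · simp at h2
  have ha : a ≠ 0 := hL a (by simp)
  have hb : b ≠ 0 := hL b (by simp)
  have hL' : ∀ m ∈ L, m ≠ 0 := fun k hk => hL k (by simp [hk])
  have hL'' : ∀ m ∈ b :: L, m ≠ 0 := fun k hk => hL k (List.mem_cons_of_mem _ hk)
  constructor
  · rw [(v_cons hd a _ ha hL'').1]
    exact List.mem_append_left _ (both_mem hd.hx hw ha e)
  · rw [(v_cons hd.symm a _ ha hL'').1, (v_cons hd b _ hb hL').1]
    exact List.mem_append_right _ (List.mem_append_left _ (both_mem hd.hx hw hb e))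

lemma main {w y u : F2} (hd : Disj w y) (hw : ∀ c, Ends w c → c = (0, true))
    (hu : u ∈ Subgroup.closure ({w, y} : Set F2)) (hp : Primitive u) :
    ∃ g : F2, u = g * w * g⁻¹ ∨ u = g * w⁻¹ * g⁻¹ ∨ u = g * y * g⁻¹ ∨ u = g * y⁻¹ * g⁻¹ := by
  obtain ⟨L, hL, h1⟩ := rep_of_mem hu
  have h2 : ∃ (g : F2) (K : List ℤ), (∀ m ∈ K, m ≠ 0) ∧ (K.length ≤ 1 ∨ Even K.length) ∧
      (u = g * v w y K * g⁻¹ ∨ u = g * v y w K * g⁻¹) := by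
    rcases h1 with rfl | rfl
    · exact conj_normal _ w y L le_rfl hL
    · obtain ⟨g, K, a, b, c⟩ := conj_normal _ y w L le_rfl hL
      exact ⟨g, K, a, b, c.symm⟩
  obtain ⟨g, K, hK, hK2, hu'⟩ := h2
  by_cases h3 : 2 ≤ K.length
  · exfalso
    have he : Even K.length := by
      rcases hK2 with h4 | h4
      · omega
      · exact h4
    obtain ⟨e, k, X, hX, hk⟩ := prim_av hp
    rcases hu' with h4 | h4
    · refine even_not_prim hd K hK he (fun e => (even_both hd hw K hK h3 e).1) (g := g⁻¹ * k) hX ?_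
      have : v w y K = g⁻¹ * u * g := by rw [h4]; group
      rw [this, hk]
      group
    · refine even_not_prim hd.symm K hK he (fun e => (even_both hd hw K hK h3 e).2)
        (g := g⁻¹ * k) hX ?_
      have : v y w K = g⁻¹ * u * g := by rw [h4]; group
      rw [this, hk]
      group
  · rcases K with _ | ⟨n, _ | ⟨b, K⟩⟩
    · exfalso
      have : u = g * w ^ (0 : ℤ) * g⁻¹ := by simpa [v] using hu'
      rw [this] at hp
      rcases prim_zpow hp with h | h <;> simp at h
    · simp only [v, mul_one] at hu'
      refine ⟨g, ?_⟩
      rcases hu' with rfl | rfl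
      · rcases prim_zpow hp with rfl | rfl <;> simp
      · rcases prim_zpow hp with rfl | rfl <;> simp
    · simp at h3

end Aux

/-- Suppose the reduced word of `w₁` is `t₁^{k₁} z₁ t₁^{-h₁}` with `h₁, k₁ ≥ 1` and `z₁`
nonempty beginning and ending with `t₂^{±1}`, and `w₂ = t₂^l` with `l ≠ 0`.  If `u` belongs
to the subgroup `J = ⟨w₁, w₂⟩` and is primitive in `F₂`, then `u` is conjugate to `w₁^{±1}`
or to `w₂^{±1}`. -/
theorem stmt17 (w₁ w₂ : F2) (k₁ h₁ : ℕ) (hk : 1 ≤ k₁) (hh : 1 ≤ h₁)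
    (z₁ : List (Fin 2 × Bool)) (hz_ne : z₁ ≠ [])
    (hz_head : (z₁.head?).map Prod.fst = some 1)
    (hz_last : (z₁.getLast?).map Prod.fst = some 1)
    (hw₁ : w₁.toWord =
      List.replicate k₁ ((0 : Fin 2), true) ++ z₁ ++ List.replicate h₁ ((0 : Fin 2), false))
    (l : ℤ) (hl : l ≠ 0) (hw₂ : w₂ = t2 ^ l)
    (u : F2) (hu : u ∈ Subgroup.closure ({w₁, w₂} : Set F2))
    (hprim : Primitive u) :
    ∃ g : F2, u = g * w₁ * g⁻¹ ∨ u = g * w₁⁻¹ * g⁻¹ ∨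
      u = g * w₂ * g⁻¹ ∨ u = g * w₂⁻¹ * g⁻¹ := by
  have hs1 : Aux.s w₁ = some (0, true) := by
    obtain ⟨k, rfl⟩ : ∃ k, k₁ = k + 1 := ⟨k₁ - 1, by omega⟩
    simp [Aux.s, hw₁, List.replicate_succ]
  have hs2 : Aux.s w₁⁻¹ = some (0, true) := by
    obtain ⟨h, rfl⟩ : ∃ h, h₁ = h + 1 := ⟨h₁ - 1, by omega⟩
    rw [Aux.s_inv, hw₁, List.replicate_succ', ← List.append_assoc, List.getLast?_concat]
    rfl
  have hE : ∀ c, Aux.Ends w₁ c → c = (0, true) := by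
    rintro c (h | h)
    · rw [hs1] at h
      exact (Option.some.inj h).symm
    · rw [hs2] at h
      exact (Option.some.inj h).symm
  have ht2 : t2 ≠ 1 := FreeGroup.of_ne_one _
  have hE2 : ∀ c, Aux.Ends w₂ c → c.1 = 1 := by
    have h0 : ∀ c, Aux.Ends t2 c → c.1 = 1 := by
      rintro c (h | h)
      · simp only [Aux.s, t2, FreeGroup.toWord_of, List.head?_cons, Option.some.injEq] at h
        rw [← h]
      · simp only [Aux.s_inv, t2, FreeGroup.toWord_of, List.getLast?_singleton, Option.map_some,
          Option.some.injEq] at h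
        rw [← h]
    subst hw₂
    rintro c (h | h)
    · exact h0 c (Aux.ends_zpow t2 hl h)
    · rw [← zpow_neg] at h
      exact h0 c (Aux.ends_zpow t2 (neg_ne_zero.mpr hl) h)
  have hd : Aux.Disj w₁ w₂ := by
    refine ⟨Aux.ne_one_of_s hs1, ?_, ?_⟩
    · rw [hw₂]
      exact Aux.zpow_ne_one ht2 hl
    · intro c h1 h2
      have h3 := hE2 c h2
      rw [hE c h1] at h3
      simp at h3
  exact Aux.main hd hE hu hprim
end
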